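/- arXiv:1311.7115 — 2 statements merged into one kernel-verified Lean document; each statement's English description precedes it below -/
import Mathlib

section
/- There is an absolute constant K > 0 such that the following holds for every 0 < eta < 1/4. Let p : R^n -> R be a degree-2 polynomial with Var_{x ~ N(0,1)^n}[p(x)] >= 1/2, let 0 <= t <= n be such that Var_{x ~ N(0,1)^n}[Tail_t(p)(x)] <= eta, and define r(x) = Head_t(p)(x) + E_{x ~ N(0,1)^n}[Tail_t(p)(x)]. Then Pr_{x ~ N(0,1)^n}[sign(r(x)) != sign(p(x))] <= K * sqrt(log(1/eta)) * eta^{1/4}. -/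
open MeasureTheory ProbabilityTheory

/-- The standard Gaussian measure `N(0,1)^n` on `ℝ^n`. -/
noncomputable def stdGaussian (n : ℕ) : Measure (Fin n → ℝ) :=
  MeasureTheory.Measure.pi fun _ => ProbabilityTheory.gaussianReal 0 1

/-- A degree-2 polynomial `x ↦ ∑_{i ≤ j} a i j * x i * x j + ∑_i b i * x i + c`. -/
noncomputable def qeval {n : ℕ} (a : Fin n → Fin n → ℝ) (b : Fin n → ℝ) (c : ℝ)
    (x : Fin n → ℝ) : ℝ :=
  (∑ i, ∑ j, if i ≤ j then a i j * x i * x j else 0) + (∑ i, b i * x i) + c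

/-- The `t`-head of a degree-2 polynomial: the part touching the first `t` coordinates. -/
noncomputable def headEval {n : ℕ} (t : ℕ) (a : Fin n → Fin n → ℝ) (b : Fin n → ℝ)
    (x : Fin n → ℝ) : ℝ :=
  (∑ i : Fin n, ∑ j : Fin n, if i.val < t ∧ i ≤ j then a i j * x i * x j else 0) +
    (∑ i : Fin n, if i.val < t then b i * x i else 0)

/-- The `t`-tail of a degree-2 polynomial: the part not touching the first `t` coordinates. -/
noncomputable def tailEval {n : ℕ} (t : ℕ) (a : Fin n → Fin n → ℝ) (b : Fin n → ℝ) (c : ℝ)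
    (x : Fin n → ℝ) : ℝ :=
  (∑ i : Fin n, ∑ j : Fin n, if t ≤ i.val ∧ i ≤ j then a i j * x i * x j else 0) +
    (∑ i : Fin n, if t ≤ i.val then b i * x i else 0) + c

/-- `sign`: `1` if `z ≥ 0`, `-1` otherwise. -/
noncomputable def sgn (z : ℝ) : ℝ := if 0 ≤ z then 1 else -1

instance isProbabilityMeasure_pi_gaussian (n : ℕ) : IsProbabilityMeasure (_root_.stdGaussian n) := by
  unfold _root_.stdGaussian; infer_instance

/-! ### Moments of the standard Gaussian -/

lemma hasDerivAt_mul_exp_sq_div_two {f : ℝ → ℝ} {f' t : ℝ} (hf : HasDerivAt f f' t) :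
    HasDerivAt (fun t => f t * Real.exp (t ^ 2 / 2)) ((f' + t * f t) * Real.exp (t ^ 2 / 2)) t := by
  have h : HasDerivAt (fun t : ℝ => t ^ 2 / 2) t t := by
    have := (hasDerivAt_pow 2 t).div_const 2
    convert! this using 1
    simp
  convert! hf.mul h.exp using 1
  ring

lemma integral_pow_gaussianReal :
    ∫ x, x ∂gaussianReal 0 1 = 0 ∧ ∫ x, x ^ 2 ∂gaussianReal 0 1 = 1 ∧
      ∫ x, x ^ 3 ∂gaussianReal 0 1 = 0 ∧ ∫ x, x ^ 4 ∂gaussianReal 0 1 = 3 := by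
  have h (k : ℕ) : ∫ x, x ^ k ∂gaussianReal 0 1 =
      iteratedDeriv k (fun t : ℝ => Real.exp (t ^ 2 / 2)) 0 := by
    have := iteratedDeriv_mgf_zero (X := id) (μ := gaussianReal 0 1) (by simp) k
    rw [mgf_id_gaussianReal] at this
    simpa using this.symm
  have d1 : deriv (fun t : ℝ => Real.exp (t ^ 2 / 2)) = fun t => t * Real.exp (t ^ 2 / 2) := by
    ext t
    have := hasDerivAt_mul_exp_sq_div_two (hasDerivAt_const t (1 : ℝ))
    simpa using this.deriv
  have d2 : deriv (fun t : ℝ => t * Real.exp (t ^ 2 / 2)) =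
      fun t => (1 + t ^ 2) * Real.exp (t ^ 2 / 2) := by
    ext t
    have := hasDerivAt_mul_exp_sq_div_two (hasDerivAt_id' t)
    rw [this.deriv]
    ring
  have d3 : deriv (fun t : ℝ => (1 + t ^ 2) * Real.exp (t ^ 2 / 2)) =
      fun t => (3 * t + t ^ 3) * Real.exp (t ^ 2 / 2) := by
    ext t
    have := hasDerivAt_mul_exp_sq_div_two ((hasDerivAt_pow 2 t).const_add 1)
    rw [this.deriv]
    push_cast; ring
  have d4 : deriv (fun t : ℝ => (3 * t + t ^ 3) * Real.exp (t ^ 2 / 2)) =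
      fun t => (3 + 6 * t ^ 2 + t ^ 4) * Real.exp (t ^ 2 / 2) := by
    ext t
    have := hasDerivAt_mul_exp_sq_div_two
      (((hasDerivAt_id t).const_mul 3).add (hasDerivAt_pow 3 t))
    convert! this.deriv using 1
    simp; ring
  refine ⟨integral_id_gaussianReal, ?_, ?_, ?_⟩ <;> rw [h] <;>
    simp [iteratedDeriv_succ, d1, d2, d3, d4]

lemma integrable_pow_gaussianReal (k : ℕ) : Integrable (fun x : ℝ => x ^ k) (gaussianReal 0 1) := by
  have := (memLp_id_gaussianReal (μ := 0) (v := 1) k).integrable_norm_pow'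
  refine this.mono' (by fun_prop) (ae_of_all _ fun x => ?_)
  simp

lemma integral_quadratic_gaussianReal (l m : ℝ) :
    ∫ x, (l * x ^ 2 + m * x) ∂gaussianReal 0 1 = l := by
  have h1 := integrable_pow_gaussianReal 1
  simp only [pow_one] at h1
  rw [integral_add ((integrable_pow_gaussianReal 2).const_mul l) (h1.const_mul m),
    integral_const_mul, integral_const_mul, integral_pow_gaussianReal.1,
    integral_pow_gaussianReal.2.1]
  ring

lemma memLp_quadratic_gaussianReal (l m : ℝ) :
    MemLp (fun x => l * x ^ 2 + m * x) 2 (gaussianReal 0 1) := by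
  rw [memLp_two_iff_integrable_sq (by fun_prop)]
  have h := (((integrable_pow_gaussianReal 4).const_mul (l ^ 2)).add
    ((integrable_pow_gaussianReal 3).const_mul (2 * l * m))).add
    ((integrable_pow_gaussianReal 2).const_mul (m ^ 2))
  refine h.congr (ae_of_all _ fun x => ?_)
  simp only [Pi.add_apply]; ring

lemma variance_quadratic_gaussianReal (l m : ℝ) :
    variance (fun x => l * x ^ 2 + m * x) (gaussianReal 0 1) = 2 * l ^ 2 + m ^ 2 := by
  rw [variance_eq_sub (memLp_quadratic_gaussianReal l m), integral_quadratic_gaussianReal]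
  have h4 := (integrable_pow_gaussianReal 4).const_mul (l ^ 2)
  have h3 := (integrable_pow_gaussianReal 3).const_mul (2 * l * m)
  have h2 := (integrable_pow_gaussianReal 2).const_mul (m ^ 2)
  have : ((fun x => l * x ^ 2 + m * x) ^ 2 : ℝ → ℝ) =
      fun x => l ^ 2 * x ^ 4 + 2 * l * m * x ^ 3 + m ^ 2 * x ^ 2 := by
    ext x; simp only [Pi.pow_apply]; ring
  simp only [this]
  rw [integral_add (by simpa using! h4.add h3) h2, integral_add h4 h3, integral_const_mul,
    integral_const_mul, integral_const_mul, integral_pow_gaussianReal.2.1,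
    integral_pow_gaussianReal.2.2.1, integral_pow_gaussianReal.2.2.2]
  ring

variable {n : ℕ}

/-- The quadratic polynomial `y ↦ ∑ i, (l i * y i ^ 2 + m i * y i)`. -/
noncomputable def diagEval (l m : Fin n → ℝ) (y : Fin n → ℝ) : ℝ :=
  ∑ i, (l i * y i ^ 2 + m i * y i)

@[fun_prop]
lemma continuous_diagEval (l m : Fin n → ℝ) : Continuous (diagEval l m) := by
  unfold diagEval; fun_prop

lemma integrable_quadratic_coordinate (l m : ℝ) (i : Fin n) :
    Integrable (fun y : Fin n → ℝ => l * y i ^ 2 + m * y i) (_root_.stdGaussian n) :=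
  integrable_comp_eval (μ := fun _ : Fin n => gaussianReal 0 1) (i := i)
    (f := fun x : ℝ => l * x ^ 2 + m * x)
    ((memLp_quadratic_gaussianReal l m).integrable one_le_two)

lemma integral_diagEval (l m : Fin n → ℝ) :
    ∫ y, diagEval l m y ∂(_root_.stdGaussian n) = ∑ i, l i := by
  unfold diagEval
  rw [integral_finsetSum _ fun i _ => integrable_quadratic_coordinate _ _ i]
  refine Finset.sum_congr rfl fun i _ => ?_
  exact (integral_comp_eval (μ := fun _ : Fin n => gaussianReal 0 1) (i := i)
    (f := fun x : ℝ => l i * x ^ 2 + m i * x) (by fun_prop)).trans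
    (integral_quadratic_gaussianReal _ _)

lemma variance_diagEval (l m : Fin n → ℝ) :
    variance (diagEval l m) (_root_.stdGaussian n) = ∑ i, (2 * l i ^ 2 + m i ^ 2) := by
  have := variance_sum_pi (μ := fun _ : Fin n => gaussianReal 0 1)
    (X := fun i x => l i * x ^ 2 + m i * x) (fun i => memLp_quadratic_gaussianReal _ _)
  simp only [variance_quadratic_gaussianReal] at this
  rw [← this]
  congr 1
  ext y
  simp [diagEval]

/-! ### Diagonalization -/

@[fun_prop]
lemma continuous_qeval (a : Fin n → Fin n → ℝ) (b : Fin n → ℝ) (c : ℝ) :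
    Continuous (qeval a b c) := by
  have (x : Fin n → ℝ) : qeval a b c x =
      (∑ i, ∑ j, (if i ≤ j then a i j else 0) * x i * x j) + (∑ i, b i * x i) + c := by
    simp [qeval, ite_mul]
  rw [funext this]; fun_prop

/-- In a suitable orthonormal basis a quadratic polynomial has no mixed terms. -/
lemma exists_measurePreserving_qeval_eq (a : Fin n → Fin n → ℝ) (b : Fin n → ℝ) (c : ℝ) :
    ∃ (U : (Fin n → ℝ) → (Fin n → ℝ)) (l m : Fin n → ℝ),
      MeasurePreserving U (_root_.stdGaussian n) (_root_.stdGaussian n) ∧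
        ∀ y, qeval a b c (U y) = diagEval l m y + c := by
  let A : Matrix (Fin n) (Fin n) ℝ := fun i j => if i ≤ j then a i j else 0
  let S : Matrix (Fin n) (Fin n) ℝ := (1 / 2 : ℝ) • (A + A.transpose)
  have hS : S.IsHermitian := by
    ext i j; simp [S, add_comm]
  have hq (x : Fin n → ℝ) : qeval a b c x = x ⬝ᵥ (S.mulVec x) + b ⬝ᵥ x + c := by
    have h1 : x ⬝ᵥ (A.transpose.mulVec x) = x ⬝ᵥ (A.mulVec x) := by
      rw [Matrix.mulVec_transpose, dotProduct_comm, Matrix.dotProduct_mulVec]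
    have h2 : x ⬝ᵥ (A.mulVec x) = ∑ i, ∑ j, if i ≤ j then a i j * x i * x j else 0 := by
      simp only [dotProduct, Matrix.mulVec, Finset.mul_sum, A]
      refine Finset.sum_congr rfl fun i _ => Finset.sum_congr rfl fun j _ => ?_
      split_ifs <;> ring
    rw [Matrix.smul_mulVec, Matrix.add_mulVec, dotProduct_smul, dotProduct_add, h1, h2]
    simp only [qeval, dotProduct, smul_eq_mul]
    ring
  let v := hS.eigenvectorBasis
  let V : (Fin n → ℝ) → EuclideanSpace ℝ (Fin n) := fun y => ∑ k, y k • v k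
  refine ⟨fun y => (V y).ofLp, hS.eigenvalues, fun k => b ⬝ᵥ (v k).ofLp, ⟨by fun_prop, ?_⟩, ?_⟩
  · have h1 := stdGaussian_eq_map_pi_orthonormalBasis v
    rw [← map_pi_eq_stdGaussian] at h1
    have h2 := congrArg (Measure.map (WithLp.ofLp (p := 2))) h1
    rw [Measure.map_map (by fun_prop) (by fun_prop), Measure.map_map (by fun_prop) (by fun_prop)]
      at h2
    have h3 : (WithLp.ofLp ∘ WithLp.toLp 2 : (Fin n → ℝ) → (Fin n → ℝ)) = id := rfl
    rw [h3, Measure.map_id] at h2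
    exact h2.symm
  · intro y
    have hV : (V y).ofLp = ∑ k, y k • (v k).ofLp := by simp [V]
    have hSv (k : Fin n) : S.mulVec (v k).ofLp = hS.eigenvalues k • (v k).ofLp :=
      hS.mulVec_eigenvectorBasis k
    have hin (k : Fin n) : (V y).ofLp ⬝ᵥ (v k).ofLp = y k := by
      have h := v.orthonormal.inner_right_fintype y k
      rw [EuclideanSpace.inner_eq_star_dotProduct] at h
      exact h
    rw [hq]
    congr 1
    have e1 : S.mulVec (V y).ofLp = ∑ k, (y k * hS.eigenvalues k) • (v k).ofLp := by
      rw [hV, Matrix.mulVec_sum]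
      refine Finset.sum_congr rfl fun k _ => ?_
      rw [Matrix.mulVec_smul, hSv, smul_smul]
    rw [e1, dotProduct_sum]
    simp only [dotProduct_smul, hin]
    rw [hV, dotProduct_sum, ← Finset.sum_add_distrib]
    unfold diagEval
    refine Finset.sum_congr rfl fun k _ => ?_
    simp only [dotProduct_smul, smul_eq_mul]
    ring

/-! ### Exponential moments of diagonal quadratic polynomials -/

lemma integral_cexp_quadratic_gaussianReal {z : ℂ} {l : ℝ} (hz : (z * l).re < 1 / 2) (m : ℝ) :
    ∫ x : ℝ, Complex.exp (z * (l * x ^ 2 + m * x : ℝ)) ∂gaussianReal 0 1 =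
      ((Real.sqrt (2 * Real.pi))⁻¹ : ℝ) * ((Real.pi / (1 / 2 - z * l)) ^ (1 / 2 : ℂ) *
        Complex.exp (z ^ 2 * m ^ 2 / (2 * (1 - 2 * (z * l))))) := by
  have hb : (z * l - 1 / 2).re < 0 := by
    simp only [Complex.sub_re]; norm_num at hz ⊢; linarith
  have key := integral_cexp_quadratic hb (z * m) 0
  have hne : z * l - 1 / 2 ≠ 0 := fun h => by rw [h] at hb; simp at hb
  have hne' : 1 - 2 * (z * l) ≠ 0 := fun h => hne (by linear_combination (-1 / 2) * h)
  rw [integral_gaussianReal_eq_integral_smul one_ne_zero]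
  simp only [gaussianPDFReal, Complex.real_smul, Complex.ofReal_mul, mul_assoc,
    NNReal.coe_one, mul_one]
  rw [integral_const_mul]
  congr 1
  convert! key using 1
  · congr 1; ext x
    rw [Complex.ofReal_exp, ← Complex.exp_add]
    congr 1; push_cast; ring
  · congr 2
    · congr 1; ring
    · field_simp
      grind

lemma norm_integral_cexp_quadratic_gaussianReal_pow_four {z : ℂ} {l : ℝ}
    (hz : (z * l).re < 1 / 2) (m : ℝ) :
    ‖∫ x : ℝ, Complex.exp (z * (l * x ^ 2 + m * x : ℝ)) ∂gaussianReal 0 1‖ ^ 4 =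
      (Complex.normSq (1 - 2 * (z * l)))⁻¹ *
        Real.exp (2 * (z ^ 2 * m ^ 2 / (1 - 2 * (z * l))).re) := by
  have hne' : 1 - 2 * (z * l) ≠ 0 := fun h => by
    have := congrArg Complex.re h
    simp at this hz
    linarith
  rw [integral_cexp_quadratic_gaussianReal hz, norm_mul, norm_mul, mul_pow, mul_pow,
    Complex.norm_exp, ← Real.exp_nat_mul, ← mul_assoc]
  congr 1
  · have h1 : ‖(Real.pi / (1 / 2 - z * l) : ℂ) ^ (1 / 2 : ℂ)‖ =
        Real.sqrt ‖(Real.pi / (1 / 2 - z * l) : ℂ)‖ := by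
      rw [Real.sqrt_eq_rpow, ← Complex.norm_cpow_real]; norm_num
    have h2 : (Real.pi / (1 / 2 - z * l) : ℂ) = (2 * Real.pi : ℝ) / (1 - 2 * (z * l)) := by
      rw [show (1 / 2 - z * l : ℂ) = (1 - 2 * (z * l)) / 2 by ring]
      push_cast; field_simp
    have h3 : (0 : ℝ) < 2 * Real.pi := by positivity
    rw [h1, h2, norm_div, Complex.norm_real, Complex.norm_real, Real.norm_of_nonneg h3.le,
      Real.norm_of_nonneg (by positivity), Complex.normSq_eq_norm_sq,
      show (4 : ℕ) = 2 * 2 from rfl, pow_mul, pow_mul, Real.sq_sqrt (by positivity), inv_pow,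
      Real.sq_sqrt h3.le]
    have : 0 < ‖1 - 2 * (z * l)‖ := norm_pos_iff.2 hne'
    field_simp
  · congr 1
    rw [show z ^ 2 * m ^ 2 / (2 * (1 - 2 * (z * l))) =
      ((1 / 2 : ℝ) : ℂ) * (z ^ 2 * m ^ 2 / (1 - 2 * (z * l))) by push_cast; field_simp,
      Complex.re_ofReal_mul]
    push_cast; ring

lemma integral_cexp_diagEval (z : ℂ) (l m : Fin n → ℝ) :
    ∫ y, Complex.exp (z * diagEval l m y) ∂(_root_.stdGaussian n) =
      ∏ i, ∫ x : ℝ, Complex.exp (z * (l i * x ^ 2 + m i * x : ℝ)) ∂gaussianReal 0 1 := by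
  unfold _root_.stdGaussian
  rw [← integral_fintype_prod_eq_prod
    (f := fun (i : Fin n) (x : ℝ) => Complex.exp (z * (l i * x ^ 2 + m i * x : ℝ)))]
  congr 1; ext y
  rw [← Complex.exp_sum, ← Finset.mul_sum, diagEval, Complex.ofReal_sum]

lemma one_add_sum_le_prod_one_add {ι : Type*} (s : Finset ι) {f : ι → ℝ} (hf : ∀ i, 0 ≤ f i) :
    1 + ∑ i ∈ s, f i ≤ ∏ i ∈ s, (1 + f i) := by
  classical
  induction s using Finset.induction_on with
  | empty => simp
  | insert i s hi ih =>
    rw [Finset.sum_insert hi, Finset.prod_insert hi]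
    have := Finset.sum_nonneg fun j (_ : j ∈ s) => hf j
    nlinarith [mul_nonneg (hf i) this, mul_le_mul_of_nonneg_left ih (add_nonneg one_pos.le (hf i))]

lemma norm_charFun_quadratic_gaussianReal_pow_four_le (s l m : ℝ) :
    ‖∫ x : ℝ, Complex.exp (s * Complex.I * (l * x ^ 2 + m * x : ℝ)) ∂gaussianReal 0 1‖ ^ 4 ≤
      (1 + 2 * s ^ 2 * (2 * l ^ 2 + m ^ 2))⁻¹ := by
  have hz : ((s * Complex.I : ℂ) * l).re < 1 / 2 := by simp
  rw [norm_integral_cexp_quadratic_gaussianReal_pow_four hz]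
  have h1 : Complex.normSq (1 - 2 * (s * Complex.I * l)) = 1 + 4 * s ^ 2 * l ^ 2 := by
    simp [Complex.normSq_apply]; ring
  have h2 : ((s * Complex.I : ℂ) ^ 2 * m ^ 2 / (1 - 2 * (s * Complex.I * l))).re =
      - (s ^ 2 * m ^ 2 / (1 + 4 * s ^ 2 * l ^ 2)) := by
    rw [show (s * Complex.I : ℂ) ^ 2 * m ^ 2 = ((-(s ^ 2 * m ^ 2) : ℝ) : ℂ) by
      rw [mul_pow, Complex.I_sq]; push_cast; ring, Complex.div_re, h1,
      Complex.ofReal_re, Complex.ofReal_im]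
    simp
    ring
  rw [h1, h2]
  have hp : 0 < 1 + 4 * s ^ 2 * l ^ 2 := by positivity
  have h3 := Real.add_one_le_exp (2 * (s ^ 2 * m ^ 2 / (1 + 4 * s ^ 2 * l ^ 2)))
  rw [mul_neg, Real.exp_neg, ← mul_inv]
  apply inv_anti₀ (by positivity)
  calc 1 + 2 * s ^ 2 * (2 * l ^ 2 + m ^ 2) = (1 + 4 * s ^ 2 * l ^ 2) *
        (2 * (s ^ 2 * m ^ 2 / (1 + 4 * s ^ 2 * l ^ 2)) + 1) := by field_simp; ring
    _ ≤ _ := mul_le_mul_of_nonneg_left h3 hp.le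

lemma norm_charFun_diagEval_pow_four_le (s : ℝ) (l m : Fin n → ℝ) :
    ‖∫ y, Complex.exp (s * Complex.I * diagEval l m y) ∂(_root_.stdGaussian n)‖ ^ 4 ≤
      (1 + 2 * s ^ 2 * ∑ i, (2 * l i ^ 2 + m i ^ 2))⁻¹ := by
  rw [integral_cexp_diagEval, norm_prod, ← Finset.prod_pow]
  refine (Finset.prod_le_prod (fun i _ => by positivity) fun i _ =>
    norm_charFun_quadratic_gaussianReal_pow_four_le s (l i) (m i)).trans ?_
  rw [Finset.prod_inv_distrib, Finset.mul_sum]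
  exact inv_anti₀ (add_pos_of_pos_of_nonneg one_pos (Finset.sum_nonneg fun i _ => by positivity))
    (one_add_sum_le_prod_one_add _ fun i => by positivity)

/-! ### Concentration -/

lemma integral_exp_quadratic_gaussianReal_pow_four_le {s l : ℝ} (hs : |2 * s * l| ≤ 1 / 2)
    (m : ℝ) :
    Integrable (fun x : ℝ => Real.exp (s * (l * x ^ 2 + m * x))) (gaussianReal 0 1) ∧
    (Real.exp (-(s * l)) * ∫ x : ℝ, Real.exp (s * (l * x ^ 2 + m * x)) ∂gaussianReal 0 1) ^ 4 ≤
      Real.exp (8 * s ^ 2 * (2 * l ^ 2 + m ^ 2)) := by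
  obtain ⟨hs1, hs2⟩ := abs_le.1 hs
  have hz : ((s : ℂ) * l).re < 1 / 2 := by
    rw [← Complex.ofReal_mul, Complex.ofReal_re]; linarith
  have key := norm_integral_cexp_quadratic_gaussianReal_pow_four hz m
  have e (x : ℝ) : Complex.exp (s * (l * x ^ 2 + m * x : ℝ)) =
      (Real.exp (s * (l * x ^ 2 + m * x)) : ℝ) := by push_cast; rfl
  simp only [e] at key
  rw [integral_complex_ofReal, Complex.norm_real, Real.norm_of_nonneg
    (integral_nonneg fun x => (Real.exp_pos _).le)] at key
  have hp : 0 < 1 - 2 * s * l := by linarith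
  have h1 : (1 - 2 * (s * l) : ℂ) = ((1 - 2 * s * l : ℝ) : ℂ) := by push_cast; ring
  have h2 : (s ^ 2 * m ^ 2 / ((1 - 2 * s * l : ℝ) : ℂ) : ℂ).re =
      s ^ 2 * m ^ 2 / (1 - 2 * s * l) := by
    rw [← Complex.ofReal_pow, ← Complex.ofReal_pow, ← Complex.ofReal_mul, ← Complex.ofReal_div,
      Complex.ofReal_re]
  rw [h1, h2, Complex.normSq_ofReal] at key
  constructor
  · refine Integrable.of_integral_ne_zero fun h => ?_
    rw [h] at key
    have : 0 < ((1 - 2 * s * l) * (1 - 2 * s * l))⁻¹ *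
      Real.exp (2 * (s ^ 2 * m ^ 2 / (1 - 2 * s * l))) := by positivity
    simp at key
    linarith
  rw [mul_pow, key, ← Real.exp_nat_mul]
  have hlog : (1 - 2 * s * l)⁻¹ ≤ Real.exp (2 * s * l + 2 * (2 * s * l) ^ 2) := by
    have h := Real.abs_log_sub_add_sum_range_le (x := 2 * s * l) (by linarith) 1
    have h' : |2 * s * l| ^ (1 + 1) / (1 - |2 * s * l|) ≤ 2 * (2 * s * l) ^ 2 := by
      rw [div_le_iff₀ (by linarith), ← sq_abs (2 * s * l)]
      generalize |2 * s * l| = a at hs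
      rw [one_add_one_eq_two]
      nlinarith [mul_nonneg (sq_nonneg a) (by linarith : 0 ≤ 1 - 2 * a)]
    have h'' := (abs_le.1 (h.trans h')).1
    simp at h''
    rw [← Real.exp_log hp, ← Real.exp_neg, Real.exp_le_exp]
    linarith
  have hm : s ^ 2 * m ^ 2 / (1 - 2 * s * l) ≤ 2 * (s ^ 2 * m ^ 2) := by
    rw [div_le_iff₀ hp]
    nlinarith [mul_nonneg (sq_nonneg s) (sq_nonneg m)]
  rw [mul_inv]
  calc _ ≤ Real.exp ((4 : ℕ) * -(s * l)) * (Real.exp (2 * s * l + 2 * (2 * s * l) ^ 2) *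
        Real.exp (2 * s * l + 2 * (2 * s * l) ^ 2) * Real.exp (2 * (2 * (s ^ 2 * m ^ 2)))) := by
        gcongr
    _ = Real.exp (16 * s ^ 2 * l ^ 2 + 4 * s ^ 2 * m ^ 2) := by
        rw [← Real.exp_add, ← Real.exp_add, ← Real.exp_add]
        congr 1; push_cast; ring
    _ ≤ _ := by
        rw [Real.exp_le_exp]
        nlinarith [mul_nonneg (sq_nonneg s) (sq_nonneg m)]

lemma mgf_diagEval_sub_mean_le {s : ℝ} {l m : Fin n → ℝ} {σ : ℝ}
    (hσ : ∑ i, (2 * l i ^ 2 + m i ^ 2) ≤ σ) (hs : 8 * s ^ 2 * σ ≤ 1) :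
    Integrable (fun y => Real.exp (s * (diagEval l m y - ∑ i, l i))) (_root_.stdGaussian n) ∧
    mgf (fun y => diagEval l m y - ∑ i, l i) (_root_.stdGaussian n) s ≤ Real.exp 1 := by
  have hl (i : Fin n) : |2 * s * l i| ≤ 1 / 2 := by
    have h := Finset.single_le_sum (f := fun i => 2 * l i ^ 2 + m i ^ 2)
      (fun i _ => by positivity) (Finset.mem_univ i)
    refine abs_le_of_sq_le_sq ?_ (by norm_num)
    nlinarith [sq_nonneg s, sq_nonneg (m i), mul_le_mul_of_nonneg_left (h.trans hσ) (sq_nonneg s),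
      mul_nonneg (sq_nonneg s) (sq_nonneg (m i))]
  have hi (i : Fin n) := integral_exp_quadratic_gaussianReal_pow_four_le (hl i) (m i)
  have e (y : Fin n → ℝ) : Real.exp (s * (diagEval l m y - ∑ i, l i)) =
      ∏ i, (Real.exp (-(s * l i)) * Real.exp (s * (l i * y i ^ 2 + m i * y i))) := by
    simp only [← Real.exp_add, ← Real.exp_sum, diagEval, Finset.sum_add_distrib,
      Finset.sum_neg_distrib, ← Finset.mul_sum]
    congr 1; ring
  have hI (i : Fin n) := (hi i).1.const_mul (Real.exp (-(s * l i)))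
  constructor
  · simp only [e]
    exact Integrable.fintype_prod (μ := fun _ : Fin n => gaussianReal 0 1) hI
  · have h4 : mgf (fun y => diagEval l m y - ∑ i, l i) (_root_.stdGaussian n) s ^ 4 ≤
        Real.exp 1 := by
      unfold mgf _root_.stdGaussian
      simp only [e]
      rw [integral_fintype_prod_eq_prod (f := fun (i : Fin n) (x : ℝ) =>
        Real.exp (-(s * l i)) * Real.exp (s * (l i * x ^ 2 + m i * x))), ← Finset.prod_pow]
      simp only [integral_const_mul]
      refine (Finset.prod_le_prod (fun i _ => by positivity) fun i _ => (hi i).2).trans ?_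
      rw [← Real.exp_sum, Real.exp_le_exp, ← Finset.mul_sum]
      exact (mul_le_mul_of_nonneg_left hσ (by positivity)).trans hs
    have h1 : (1 : ℝ) ≤ Real.exp 1 := Real.one_le_exp zero_le_one
    refine le_of_pow_le_pow_left₀ (n := 4) (by norm_num) (by positivity) (h4.trans ?_)
    exact le_self_pow₀ h1 (by norm_num)

lemma measureReal_abs_diagEval_sub_mean_ge_le {l m : Fin n → ℝ} {σ : ℝ} (hσ0 : 0 < σ)
    (hσ : ∑ i, (2 * l i ^ 2 + m i ^ 2) ≤ σ) (τ : ℝ) :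
    (_root_.stdGaussian n).real {y | τ ≤ |diagEval l m y - ∑ i, l i|} ≤
      2 * Real.exp 1 * Real.exp (-(τ / (4 * Real.sqrt σ))) := by
  have hr := Real.sqrt_pos.2 hσ0
  have hs (s : ℝ) (h : s ^ 2 = (1 / (4 * Real.sqrt σ)) ^ 2) : 8 * s ^ 2 * σ ≤ 1 := by
    rw [h, div_pow, mul_pow, Real.sq_sqrt hσ0.le]
    field_simp
    norm_num
  have a1 := mgf_diagEval_sub_mean_le hσ (hs (1 / (4 * Real.sqrt σ)) rfl)
  have a2 := mgf_diagEval_sub_mean_le hσ (hs (-(1 / (4 * Real.sqrt σ))) (by ring))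
  have b1 := measure_ge_le_exp_mul_mgf τ (by positivity) a1.1
  have b2 := measure_le_le_exp_mul_mgf (-τ) (neg_nonpos.2 (by positivity)) a2.1
  have c1 := b1.trans (mul_le_mul_of_nonneg_left a1.2 (Real.exp_pos _).le)
  have c2 := b2.trans (mul_le_mul_of_nonneg_left a2.2 (Real.exp_pos _).le)
  have hsub : {y | τ ≤ |diagEval l m y - ∑ i, l i|} ⊆
      {y | τ ≤ diagEval l m y - ∑ i, l i} ∪ {y | diagEval l m y - ∑ i, l i ≤ -τ} := by
    intro y hy
    rcases le_abs.1 (Set.mem_ofPred_eq ▸ hy) with h | h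
    · exact Or.inl h
    · exact Or.inr (by simp only [Set.mem_ofPred_eq]; linarith)
  refine (measureReal_mono hsub).trans ((measureReal_union_le _ _).trans
    ((add_le_add c1 c2).trans_eq ?_))
  rw [show -(1 / (4 * Real.sqrt σ)) * τ = -(τ / (4 * Real.sqrt σ)) by ring,
    show - -(1 / (4 * Real.sqrt σ)) * -τ = -(τ / (4 * Real.sqrt σ)) by ring]
  ring

/-! ### Anti-concentration -/

lemma integrable_abs_rpow_gaussianReal :
    Integrable (fun u : ℝ => |u| ^ (-(1 / 2) : ℝ)) (gaussianReal 0 1) := by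
  have h : Integrable (fun u : ℝ => |u| ^ (-(1 / 2) : ℝ) * Real.exp (-(1 / 2) * |u| ^ 2)) := by
    refine Integrable.of_integral_ne_zero ?_
    rw [integral_comp_abs (f := fun u : ℝ => u ^ (-(1 / 2) : ℝ) * Real.exp (-(1 / 2) * u ^ 2))]
    have hpos : 0 < ∫ u in Set.Ioi (0 : ℝ),
        u ^ (-(1 / 2) : ℝ) * Real.exp (-(1 / 2) * u ^ 2) := by
      have hi := (integrable_rpow_mul_exp_neg_mul_sq (b := 1 / 2) (by norm_num)
        (s := -(1 / 2)) (by norm_num)).integrableOn (s := Set.Ioi 0)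
      rw [setIntegral_pos_iff_support_of_nonneg_ae _ hi]
      · refine lt_of_lt_of_le (by simp) (measure_mono (s := Set.Ioi 0) fun u hu =>
          ⟨?_, hu⟩)
        have hu : 0 < u := hu
        exact (mul_pos (Real.rpow_pos_of_pos hu _) (Real.exp_pos _)).ne'
      · exact (ae_restrict_iff' measurableSet_Ioi).2 (ae_of_all _ fun u hu =>
          mul_nonneg (Real.rpow_nonneg (le_of_lt hu) _) (Real.exp_pos _).le)
    positivity
  rw [gaussianReal_of_var_ne_zero _ one_ne_zero, integrable_withDensity_iff_integrable_smul'
    (measurable_gaussianPDF _ _) (ae_of_all _ fun _ => gaussianPDF_lt_top)]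
  refine (h.const_mul (Real.sqrt (2 * Real.pi))⁻¹).congr (ae_of_all _ fun u => ?_)
  simp only [toReal_gaussianPDF, gaussianPDFReal, smul_eq_mul, sq_abs, NNReal.coe_one, mul_one,
    sub_zero]
  rw [show -(1 / 2) * u ^ 2 = -u ^ 2 / 2 by ring]
  ring

lemma integral_cexp_mul_gaussianReal (w : ℝ) :
    ∫ u : ℝ, Complex.exp (u * Complex.I * w) ∂gaussianReal 0 1 = Real.exp (-(w ^ 2) / 2) := by
  have h := charFun_gaussianReal (μ := 0) (v := 1) w
  rw [charFun_apply_real] at h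
  convert! h using 1
  · congr 1; ext u; congr 1; ring
  · push_cast; congr 1; simp; ring

/-- Carbery–Wright inequality for quadratic polynomials with no mixed terms. -/
lemma measureReal_abs_diagEval_add_le_le {l m : Fin n → ℝ}
    (hV : 1 / 2 ≤ ∑ i, (2 * l i ^ 2 + m i ^ 2)) (c : ℝ) {τ : ℝ} (hτ : 0 < τ) :
    (_root_.stdGaussian n).real {y | |diagEval l m y + c| ≤ τ} ≤
      Real.exp (1 / 2) * (∫ u, |u| ^ (-(1 / 2) : ℝ) ∂gaussianReal 0 1) * Real.sqrt τ := by
  set γ := _root_.stdGaussian n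
  set F : (Fin n → ℝ) → ℝ := fun y => (diagEval l m y + c) / τ with hF
  have hFc : Continuous F := by fun_prop
  have hint : Integrable (fun y => Real.exp (-(F y ^ 2) / 2)) γ := by
    refine Integrable.of_bound (C := 1) (by fun_prop) (ae_of_all _ fun y => ?_)
    rw [Real.norm_of_nonneg (Real.exp_pos _).le, Real.exp_le_one_iff]
    nlinarith [sq_nonneg (F y)]
  have h1 : γ.real {y | |diagEval l m y + c| ≤ τ} ≤
      Real.exp (1 / 2) * ∫ y, Real.exp (-(F y ^ 2) / 2) ∂γ := by
    have hsub : {y | |diagEval l m y + c| ≤ τ} ⊆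
        {y | Real.exp (-(1 / 2)) ≤ Real.exp (-(F y ^ 2) / 2)} := by
      intro y hy
      have hy' : |diagEval l m y + c| ≤ τ := hy
      have : |F y| ≤ 1 := by
        rw [hF]; simp only [abs_div, abs_of_pos hτ]
        exact (div_le_one hτ).2 hy'
      have h2 : F y ^ 2 ≤ 1 := (sq_le_one_iff_abs_le_one _).2 this
      exact Real.exp_le_exp.2 (by linarith)
    have hm := mul_meas_ge_le_integral_of_nonneg (ae_of_all γ fun y => (Real.exp_pos _).le) hint
      (Real.exp (-(1 / 2)))
    calc γ.real {y | |diagEval l m y + c| ≤ τ}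
        ≤ γ.real {y | Real.exp (-(1 / 2)) ≤ Real.exp (-(F y ^ 2) / 2)} := measureReal_mono hsub
      _ = Real.exp (1 / 2) * (Real.exp (-(1 / 2)) *
          γ.real {y | Real.exp (-(1 / 2)) ≤ Real.exp (-(F y ^ 2) / 2)}) := by
          rw [← mul_assoc, ← Real.exp_add]; simp
      _ ≤ _ := mul_le_mul_of_nonneg_left hm (Real.exp_pos _).le
  have h2 : ((∫ y, Real.exp (-(F y ^ 2) / 2) ∂γ : ℝ) : ℂ) =
      ∫ u : ℝ, ∫ y, Complex.exp (u * Complex.I * F y) ∂γ ∂gaussianReal 0 1 := by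
    rw [← integral_complex_ofReal]
    simp only [← integral_cexp_mul_gaussianReal]
    refine integral_integral_swap (Integrable.of_bound (C := 1) ?_ (ae_of_all _ fun p => ?_))
    · exact Continuous.aestronglyMeasurable (by unfold Function.uncurry; fun_prop)
    · simp [Function.uncurry, Complex.norm_exp]
  have h3 (u : ℝ) (hu : u ≠ 0) : ‖∫ y, Complex.exp (u * Complex.I * F y) ∂γ‖ ≤
      |u| ^ (-(1 / 2) : ℝ) * Real.sqrt τ := by
    have e (y : Fin n → ℝ) : Complex.exp (u * Complex.I * F y) =
        Complex.exp ((u / τ : ℝ) * Complex.I * diagEval l m y) *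
          Complex.exp ((u * c / τ : ℝ) * Complex.I) := by
      rw [← Complex.exp_add, hF]; congr 1; push_cast; ring
    simp only [e]
    rw [integral_mul_const, norm_mul, Complex.norm_exp_ofReal_mul_I, mul_one]
    refine le_of_pow_le_pow_left₀ (n := 4) (by norm_num) (by positivity)
      ((norm_charFun_diagEval_pow_four_le (u / τ) l m).trans ?_)
    have hu' : 0 < |u| := abs_pos.2 hu
    have r1 : (|u| ^ (-(1 / 2) : ℝ)) ^ 4 = (u ^ 2)⁻¹ := by
      rw [← Real.rpow_natCast, ← Real.rpow_mul hu'.le, ← sq_abs,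
        show (-(1 / 2) * ((4 : ℕ) : ℝ) : ℝ) = -((2 : ℕ) : ℝ) by norm_num,
        Real.rpow_neg hu'.le, Real.rpow_natCast]
    rw [mul_pow, r1, show (4 : ℕ) = 2 * 2 from rfl, pow_mul, Real.sq_sqrt hτ.le]
    have hu2 : 0 < u ^ 2 := by positivity
    have : u ^ 2 / τ ^ 2 ≤ 1 + 2 * (u / τ) ^ 2 * ∑ i, (2 * l i ^ 2 + m i ^ 2) := by
      rw [← div_pow]
      nlinarith [mul_le_mul_of_nonneg_left hV (sq_nonneg (u / τ))]
    calc _ ≤ (u ^ 2 / τ ^ 2)⁻¹ := inv_anti₀ (by positivity) this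
      _ = _ := by rw [inv_div]; ring
  have h4 : ∫ y, Real.exp (-(F y ^ 2) / 2) ∂γ ≤
      (∫ u, |u| ^ (-(1 / 2) : ℝ) ∂gaussianReal 0 1) * Real.sqrt τ := by
    have hn : ‖((∫ y, Real.exp (-(F y ^ 2) / 2) ∂γ : ℝ) : ℂ)‖ =
        ∫ y, Real.exp (-(F y ^ 2) / 2) ∂γ := by
      rw [Complex.norm_real, Real.norm_of_nonneg (integral_nonneg fun y => (Real.exp_pos _).le)]
    rw [← hn, h2, ← integral_mul_const]
    refine norm_integral_le_of_norm_le (integrable_abs_rpow_gaussianReal.mul_const _) ?_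
    have := nullSingletonClass_gaussianReal (μ := 0) (v := 1) one_ne_zero
    filter_upwards [compl_mem_ae_iff.2 (measure_singleton (0 : ℝ))] with u hu
    exact h3 u hu
  refine h1.trans ((mul_le_mul_of_nonneg_left h4 (Real.exp_pos _).le).trans_eq ?_)
  ring

/-! ### General quadratic polynomials -/

lemma variance_qeval_eq {a : Fin n → Fin n → ℝ} {b : Fin n → ℝ} {c : ℝ}
    {U : (Fin n → ℝ) → (Fin n → ℝ)} {l m : Fin n → ℝ}
    (hU : MeasurePreserving U (_root_.stdGaussian n) (_root_.stdGaussian n))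
    (h : ∀ y, qeval a b c (U y) = diagEval l m y + c) :
    variance (qeval a b c) (_root_.stdGaussian n) = ∑ i, (2 * l i ^ 2 + m i ^ 2) := by
  rw [← hU.variance_fun_comp (by fun_prop : Continuous (qeval a b c)).aemeasurable]
  simp only [h]
  rw [variance_add_const (by fun_prop : Continuous (diagEval l m)).aestronglyMeasurable,
    variance_diagEval]

lemma integral_qeval_eq {a : Fin n → Fin n → ℝ} {b : Fin n → ℝ} {c : ℝ}
    {U : (Fin n → ℝ) → (Fin n → ℝ)} {l m : Fin n → ℝ}
    (hU : MeasurePreserving U (_root_.stdGaussian n) (_root_.stdGaussian n))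
    (h : ∀ y, qeval a b c (U y) = diagEval l m y + c) :
    ∫ x, qeval a b c x ∂(_root_.stdGaussian n) = ∑ i, l i + c := by
  rw [← hU.map_eq, integral_map hU.aemeasurable
    (by fun_prop : Continuous (qeval a b c)).aestronglyMeasurable]
  simp only [h]
  rw [integral_add ?_ (integrable_const _), integral_diagEval]
  · simp
  · exact integrable_finsetSum _ fun i _ => integrable_quadratic_coordinate _ _ i

/-- Carbery–Wright inequality for quadratic polynomials. -/
lemma measureReal_abs_qeval_le_le {a : Fin n → Fin n → ℝ} {b : Fin n → ℝ} {c : ℝ}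
    (hV : 1 / 2 ≤ variance (qeval a b c) (_root_.stdGaussian n)) {τ : ℝ} (hτ : 0 < τ) :
    (_root_.stdGaussian n).real {x | |qeval a b c x| ≤ τ} ≤
      Real.exp (1 / 2) * (∫ u, |u| ^ (-(1 / 2) : ℝ) ∂gaussianReal 0 1) * Real.sqrt τ := by
  obtain ⟨U, l, m, hU, h⟩ := exists_measurePreserving_qeval_eq a b c
  rw [variance_qeval_eq hU h] at hV
  rw [← hU.measureReal_preimage
    (measurableSet_le (by fun_prop) (by fun_prop)).nullMeasurableSet]
  simp only [Set.preimage_ofPred_eq, h]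
  exact measureReal_abs_diagEval_add_le_le hV c hτ

/-- Exponential concentration of quadratic polynomials around their mean. -/
lemma measureReal_abs_qeval_sub_mean_ge_le {a : Fin n → Fin n → ℝ} {b : Fin n → ℝ} {c σ : ℝ}
    (hσ0 : 0 < σ) (hσ : variance (qeval a b c) (_root_.stdGaussian n) ≤ σ) (τ : ℝ) :
    (_root_.stdGaussian n).real
        {x | τ ≤ |qeval a b c x - ∫ y, qeval a b c y ∂(_root_.stdGaussian n)|} ≤
      2 * Real.exp 1 * Real.exp (-(τ / (4 * Real.sqrt σ))) := by
  obtain ⟨U, l, m, hU, h⟩ := exists_measurePreserving_qeval_eq a b c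
  rw [variance_qeval_eq hU h] at hσ
  rw [integral_qeval_eq hU h, ← hU.measureReal_preimage
    (measurableSet_le (by fun_prop) (by fun_prop)).nullMeasurableSet]
  simp only [Set.preimage_ofPred_eq, h, add_sub_add_right_eq_sub]
  exact measureReal_abs_diagEval_sub_mean_ge_le hσ0 hσ τ

lemma tailEval_eq_qeval (t : ℕ) (a : Fin n → Fin n → ℝ) (b : Fin n → ℝ) (c : ℝ) :
    tailEval t a b c = qeval (fun i j => if t ≤ i.val then a i j else 0)
      (fun i => if t ≤ i.val then b i else 0) c := by
  ext x
  unfold tailEval qeval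
  congr 2
  · refine Finset.sum_congr rfl fun i _ => Finset.sum_congr rfl fun j _ => ?_
    split_ifs <;> simp_all
  · exact Finset.sum_congr rfl fun i _ => by simp only [ite_mul, zero_mul]

lemma headEval_add_tailEval (t : ℕ) (a : Fin n → Fin n → ℝ) (b : Fin n → ℝ) (c : ℝ)
    (x : Fin n → ℝ) : headEval t a b x + tailEval t a b c x = qeval a b c x := by
  have h1 : (∑ i : Fin n, ∑ j : Fin n, if i.val < t ∧ i ≤ j then a i j * x i * x j else 0) +
      (∑ i : Fin n, ∑ j : Fin n, if t ≤ i.val ∧ i ≤ j then a i j * x i * x j else 0) =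
      ∑ i, ∑ j, if i ≤ j then a i j * x i * x j else 0 := by
    simp only [← Finset.sum_add_distrib]
    refine Finset.sum_congr rfl fun i _ => Finset.sum_congr rfl fun j _ => ?_
    rcases lt_or_ge i.val t with h | h
    · simp [h, not_le.2 h]
    · simp [h, not_lt.2 h]
  have h2 : (∑ i : Fin n, if i.val < t then b i * x i else 0) +
      (∑ i : Fin n, if t ≤ i.val then b i * x i else 0) = ∑ i, b i * x i := by
    rw [← Finset.sum_add_distrib]
    refine Finset.sum_congr rfl fun i _ => ?_
    rcases lt_or_ge i.val t with h | h
    · simp [h, not_le.2 h]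
    · simp [h, not_lt.2 h]
  unfold headEval tailEval qeval
  linarith

lemma abs_le_of_sgn_ne {u v : ℝ} (h : sgn u ≠ sgn v) : |v| ≤ |v - u| := by
  unfold sgn at h
  split_ifs at h with h1 h2 h2
  · exact absurd rfl h
  · rw [abs_of_neg (not_le.1 h2), abs_of_neg (by linarith)]; linarith
  · rw [abs_of_nonneg h2, abs_of_nonneg (by linarith)]; linarith
  · exact absurd rfl h

/-- replacing a low-variance tail of a degree-2 Gaussian polynomial by its
expectation rarely changes the sign. -/
theorem stmt_7 :
    ∃ K : ℝ, 0 < K ∧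
      ∀ (n t : ℕ) (a : Fin n → Fin n → ℝ) (b : Fin n → ℝ) (c : ℝ) (η : ℝ),
        0 < η → η < 1 / 4 → t ≤ n →
        1 / 2 ≤ variance (qeval a b c) (stdGaussian n) →
        variance (tailEval t a b c) (stdGaussian n) ≤ η →
        ((stdGaussian n) {x |
            sgn (headEval t a b x + ∫ y, tailEval t a b c y ∂(stdGaussian n)) ≠
              sgn (qeval a b c x)}).toReal
          ≤ K * Real.sqrt (Real.log (1 / η)) * η ^ ((1 : ℝ) / 4) := by
  set C := ∫ u, |u| ^ (-(1 / 2) : ℝ) ∂gaussianReal 0 1 with hC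
  have hC0 : 0 ≤ C := integral_nonneg fun u => by positivity
  refine ⟨Real.exp (1 / 2) * C + 2 * Real.exp 1, by positivity, ?_⟩
  intro n t a b c η hη hη4 _ hV hT
  set L := Real.log (1 / η) with hLdef
  have hL : 1 ≤ L := by
    rw [hLdef, Real.le_log_iff_exp_le (by positivity), le_div_iff₀ hη]
    nlinarith [Real.exp_one_lt_d9, Real.exp_pos 1]
  have hτ : 0 < Real.sqrt η * L := mul_pos (Real.sqrt_pos.2 hη) (by linarith)
  set τ := Real.sqrt η * L
  have hq : Real.sqrt (Real.sqrt η) = η ^ ((1 : ℝ) / 4) := by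
    rw [Real.sqrt_eq_rpow, Real.sqrt_eq_rpow, ← Real.rpow_mul hη.le]; norm_num
  have hsub : {x | sgn (headEval t a b x + ∫ y, tailEval t a b c y ∂(_root_.stdGaussian n)) ≠
        sgn (qeval a b c x)} ⊆ {x | |qeval a b c x| ≤ τ} ∪
      {x | τ ≤ |tailEval t a b c x - ∫ y, tailEval t a b c y ∂(_root_.stdGaussian n)|} := by
    intro x hx
    have h := abs_le_of_sgn_ne hx
    rw [← headEval_add_tailEval t a b c x, add_sub_add_left_eq_sub, headEval_add_tailEval] at h
    rcases le_total |qeval a b c x| τ with h' | h'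
    · exact Or.inl h'
    · exact Or.inr (h'.trans h)
  have hsmall := measureReal_abs_qeval_le_le hV hτ
  have htail : (_root_.stdGaussian n).real
      {x | τ ≤ |tailEval t a b c x - ∫ y, tailEval t a b c y ∂(_root_.stdGaussian n)|} ≤
      2 * Real.exp 1 * η ^ ((1 : ℝ) / 4) := by
    rw [tailEval_eq_qeval] at hT ⊢
    refine (measureReal_abs_qeval_sub_mean_ge_le hη hT τ).trans_eq ?_
    congr 1
    rw [Real.rpow_def_of_pos hη]
    congr 1
    have : L = -Real.log η := by rw [hLdef, one_div, Real.log_inv]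
    have hs := Real.sqrt_pos.2 hη
    simp only [τ, this]
    field_simp
  have hsq : Real.sqrt τ = Real.sqrt L * η ^ ((1 : ℝ) / 4) := by
    rw [Real.sqrt_mul (Real.sqrt_nonneg _), hq, mul_comm]
  have hsL : 1 ≤ Real.sqrt L := Real.one_le_sqrt.2 hL
  have hη' : 0 < η ^ ((1 : ℝ) / 4) := Real.rpow_pos_of_pos hη _
  calc _ ≤ _ := measureReal_mono hsub
    _ ≤ _ := measureReal_union_le _ _
    _ ≤ Real.exp (1 / 2) * C * (Real.sqrt L * η ^ ((1 : ℝ) / 4)) +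
        2 * Real.exp 1 * η ^ ((1 : ℝ) / 4) := add_le_add (hsq ▸ hsmall) htail
    _ ≤ Real.exp (1 / 2) * C * (Real.sqrt L * η ^ ((1 : ℝ) / 4)) +
        2 * Real.exp 1 * (Real.sqrt L * η ^ ((1 : ℝ) / 4)) := by
        gcongr
        exact le_mul_of_one_le_left hη'.le hsL
    _ = _ := by ring
end

section
/- There is an absolute constant c > 0 such that the following holds. Let p_1,...,p_k be degree-d multilinear polynomials over {-1,1}^n, each of which is tau-regular, and let P_i(x) = sign(p_i(x)) for i in [k]. Then for every function g : {-1,1}^k -> {-1,1}, | Pr_{x uniform on {-1,1}^n}[g(P_1(x),...,P_k(x)) = 1] - Pr_{G ~ N(0,1)^n}[g(P_1(G),...,P_k(G)) = 1] | <= 2^{c*k} * 2^{c*d} * tau^{1/(8d)}. -/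
open scoped Classical
open MeasureTheory ProbabilityTheory

/-- Evaluation of the multilinear polynomial with Fourier coefficients `f` at `x ∈ ℝ^n`. -/
noncomputable def peval {n : ℕ} (f : Finset (Fin n) → ℝ) (x : Fin n → ℝ) : ℝ :=
  ∑ S : Finset (Fin n), f S * ∏ i ∈ S, x i

/-- `f` has degree at most `d`: coefficients of monomials with more than `d` variables vanish. -/
def degLE {n : ℕ} (f : Finset (Fin n) → ℝ) (d : ℕ) : Prop :=
  ∀ S : Finset (Fin n), d < S.card → f S = 0

/-- Influence of variable `i` on the multilinear polynomial with coefficients `f`. -/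
noncomputable def binf {n : ℕ} (f : Finset (Fin n) → ℝ) (i : Fin n) : ℝ :=
  ∑ S : Finset (Fin n), if i ∈ S then f S ^ 2 else 0

/-- Variance (under uniform `{-1,1}^n`) of the multilinear polynomial with coefficients `f`. -/
noncomputable def bvar {n : ℕ} (f : Finset (Fin n) → ℝ) : ℝ :=
  ∑ S : Finset (Fin n), if S ≠ ∅ then f S ^ 2 else 0

/-- Probability of `P` under the uniform distribution on `{-1,1}^n`. -/
noncomputable def bprob (n : ℕ) (P : (Fin n → ℝ) → Prop) : ℝ :=
  ((Finset.univ.filter fun x : Fin n → Bool =>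
      P (fun i => if x i then 1 else -1)).card : ℝ) / 2 ^ n

/-- Fourier coefficients of the restriction of `f` fixing the variables in `S` to the values
of `ρ`:  for `U` disjoint from `S`, the coefficient is
`∑_{T ⊆ S} f (T ∪ U) ∏_{i ∈ T} ρ i`, and coefficients of sets meeting `S` vanish. -/
noncomputable def restrictC {n : ℕ} (f : Finset (Fin n) → ℝ) (S : Finset (Fin n))
    (ρ : Fin n → ℝ) : Finset (Fin n) → ℝ :=
  fun U => if Disjoint U S then ∑ T ∈ S.powerset, f (T ∪ U) * ∏ i ∈ T, ρ i else 0

namespace Multilin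

/-- Laws on the line whose first three moments are those of the standard Gaussian, and whose
fourth moment is at most the Gaussian one. -/
structure IsStd (μ : Measure ℝ) : Prop where
  prob : IsProbabilityMeasure μ
  integrable_pow : ∀ k : ℕ, Integrable (fun t : ℝ => t ^ k) μ
  moment_one : ∫ t, t ∂μ = 0
  moment_two : ∫ t, t ^ 2 ∂μ = 1
  moment_three : ∫ t, t ^ 3 ∂μ = 0
  moment_four : ∫ t, t ^ 4 ∂μ ≤ 3

/-- The multilinear polynomial with coefficients `f`, over an arbitrary finite index type. -/
noncomputable def mev {ι : Type} [Fintype ι] (f : Finset ι → ℝ) (x : ι → ℝ) : ℝ :=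
  ∑ S : Finset ι, f S * ∏ i ∈ S, x i

/-- Coefficients of the partial derivative in the variable `l`. -/
def mder {ι : Type} [DecidableEq ι] (l : ι) (f : Finset ι → ℝ) : Finset ι → ℝ :=
  fun S => if l ∈ S then 0 else f (insert l S)

/-- Coefficients of the part not involving the variable `l`. -/
def mfree {ι : Type} [DecidableEq ι] (l : ι) (f : Finset ι → ℝ) : Finset ι → ℝ :=
  fun S => if l ∈ S then 0 else f S

theorem sum_insert_eq {ι : Type} [Fintype ι] [DecidableEq ι] (l : ι) (F : Finset ι → ℝ) :
    ∑ S, (if l ∈ S then 0 else F (insert l S)) = ∑ S, if l ∈ S then F S else 0 := by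
  have h1 : ∑ S, (if l ∈ S then 0 else F (insert l S))
      = ∑ S with l ∉ S, F (insert l S) := by
    rw [Finset.sum_filter]; exact Finset.sum_congr rfl fun S _ => by split_ifs <;> simp_all
  rw [h1, ← Finset.sum_filter]
  refine Finset.sum_nbij' (fun S => insert l S) (fun S => S.erase l) ?_ ?_ ?_ ?_ ?_
  · simp
  · simp
  · intro S hS; simp at hS; simp [hS]
  · intro S hS; simp at hS; simp [Finset.insert_erase hS]
  · simp

theorem sum_split {ι : Type} [Fintype ι] [DecidableEq ι] (l : ι) (F : Finset ι → ℝ) :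
    ∑ S, F S = ∑ S, (if l ∈ S then 0 else F S) + ∑ S, (if l ∈ S then 0 else F (insert l S)) := by
  rw [sum_insert_eq, ← Finset.sum_add_distrib]
  exact Finset.sum_congr rfl fun S _ => by split_ifs <;> simp

theorem mev_split {ι : Type} [Fintype ι] [DecidableEq ι] (l : ι) (f : Finset ι → ℝ)
    (x : ι → ℝ) : mev f x = mev (mfree l f) x + x l * mev (mder l f) x := by
  unfold mev
  rw [sum_split l, Finset.mul_sum]
  congr 1
  · exact Finset.sum_congr rfl fun S _ => by unfold mfree; split_ifs <;> simp
  · refine Finset.sum_congr rfl fun S _ => ?_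
    unfold mder
    split_ifs with h
    · simp
    · rw [Finset.prod_insert h]; ring

theorem mev_update_of_free {ι : Type} [Fintype ι] [DecidableEq ι] (l : ι) (f : Finset ι → ℝ)
    (hf : ∀ S, l ∈ S → f S = 0) (x : ι → ℝ) (t : ℝ) :
    mev f (Function.update x l t) = mev f x := by
  refine Finset.sum_congr rfl fun S _ => ?_
  by_cases h : l ∈ S
  · simp [hf S h]
  · congr 1
    exact Finset.prod_congr rfl fun i hi => by
      rw [Function.update_of_ne]; rintro rfl; exact h hi

theorem mev_update {ι : Type} [Fintype ι] [DecidableEq ι] (l : ι) (f : Finset ι → ℝ)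
    (x : ι → ℝ) (t : ℝ) :
    mev f (Function.update x l t) = mev (mfree l f) x + t * mev (mder l f) x := by
  rw [mev_split l, mev_update_of_free l (mfree l f), mev_update_of_free l (mder l f)]
  · simp
  · intro S h; simp [mder, h]
  · intro S h; simp [mfree, h]

theorem sum_weight_split {ι : Type} [Fintype ι] [DecidableEq ι] (l : ι) (f : Finset ι → ℝ)
    (w : ℝ) : ∑ S, w ^ S.card * f S ^ 2
      = ∑ S, w ^ S.card * mfree l f S ^ 2 + w * ∑ S, w ^ S.card * mder l f S ^ 2 := by
  rw [sum_split l, Finset.mul_sum]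
  congr 1
  · exact Finset.sum_congr rfl fun S _ => by unfold mfree; split_ifs <;> simp
  · refine Finset.sum_congr rfl fun S _ => ?_
    unfold mder
    split_ifs with h
    · simp
    · rw [Finset.card_insert_of_notMem h]; ring

theorem sum_mder_sq {ι : Type} [Fintype ι] [DecidableEq ι] (l : ι) (f : Finset ι → ℝ) :
    ∑ S, mder l f S ^ 2 = ∑ S, if l ∈ S then f S ^ 2 else 0 := by
  rw [← sum_insert_eq]
  exact Finset.sum_congr rfl fun S _ => by unfold mder; split_ifs <;> simp

theorem sum_sum_mder_sq {ι : Type} [Fintype ι] [DecidableEq ι] (f : Finset ι → ℝ) :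
    ∑ l, ∑ S, mder l f S ^ 2 = ∑ S, (S.card : ℝ) * f S ^ 2 := by
  simp_rw [sum_mder_sq]
  rw [Finset.sum_comm]
  refine Finset.sum_congr rfl fun S _ => ?_
  rw [← Finset.sum_filter]; simp

/-- Functions given by real polynomials in the coordinates. -/
def IsPoly {ι : Type} (F : (ι → ℝ) → ℝ) : Prop :=
  ∃ P : MvPolynomial ι ℝ, ∀ x, F x = MvPolynomial.eval x P

theorem IsPoly.add {ι : Type} {F G : (ι → ℝ) → ℝ} (hF : IsPoly F) (hG : IsPoly G) :
    IsPoly fun x => F x + G x := by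
  obtain ⟨P, hP⟩ := hF; obtain ⟨Q, hQ⟩ := hG; exact ⟨P + Q, fun x => by simp [hP, hQ]⟩

theorem IsPoly.mul {ι : Type} {F G : (ι → ℝ) → ℝ} (hF : IsPoly F) (hG : IsPoly G) :
    IsPoly fun x => F x * G x := by
  obtain ⟨P, hP⟩ := hF; obtain ⟨Q, hQ⟩ := hG; exact ⟨P * Q, fun x => by simp [hP, hQ]⟩

theorem IsPoly.pow {ι : Type} {F : (ι → ℝ) → ℝ} (hF : IsPoly F) (k : ℕ) :
    IsPoly fun x => F x ^ k := by
  obtain ⟨P, hP⟩ := hF; exact ⟨P ^ k, fun x => by simp [hP]⟩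

theorem IsPoly.const {ι : Type} (c : ℝ) : IsPoly fun _ : ι → ℝ => c :=
  ⟨MvPolynomial.C c, fun x => by simp⟩

theorem IsPoly.coord {ι : Type} (i : ι) : IsPoly fun x : ι → ℝ => x i :=
  ⟨MvPolynomial.X i, fun x => by simp⟩

theorem IsPoly.sum {ι α : Type} {F : α → (ι → ℝ) → ℝ} (s : Finset α)
    (hF : ∀ a, IsPoly (F a)) : IsPoly fun x => ∑ a ∈ s, F a x := by
  choose P hP using hF
  exact ⟨∑ a ∈ s, P a, fun x => by simp [hP]⟩

theorem IsPoly.prod {ι α : Type} {F : α → (ι → ℝ) → ℝ} (s : Finset α)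
    (hF : ∀ a, IsPoly (F a)) : IsPoly fun x => ∏ a ∈ s, F a x := by
  choose P hP using hF
  exact ⟨∏ a ∈ s, P a, fun x => by simp [hP]⟩

theorem isPoly_mev {ι : Type} [Fintype ι] (f : Finset ι → ℝ) : IsPoly (mev f) :=
  IsPoly.sum _ fun _ => (IsPoly.const _).mul (IsPoly.prod _ fun i => IsPoly.coord i)

theorem IsPoly.continuous {ι : Type} {F : (ι → ℝ) → ℝ} (hF : IsPoly F) : Continuous F := by
  obtain ⟨P, hP⟩ := hF
  rw [show F = fun x => MvPolynomial.eval x P from funext hP]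
  exact MvPolynomial.continuous_eval P

theorem IsPoly.integrable {ι : Type} [Fintype ι] {F : (ι → ℝ) → ℝ} (hF : IsPoly F)
    {μ : ι → Measure ℝ} (hμ : ∀ i, IsStd (μ i)) : Integrable F (Measure.pi μ) := by
  have := fun i => (hμ i).prob
  obtain ⟨P, hP⟩ := hF
  rw [show F = fun x => MvPolynomial.eval x P from funext hP]
  simp_rw [MvPolynomial.eval_eq']
  exact integrable_finsetSum _ fun s _ =>
    (Integrable.fintype_prod (f := fun i t => t ^ s i)
      fun i => (hμ i).integrable_pow (s i)).const_mul _

theorem measurePreserving_update {ι : Type} [Fintype ι] [DecidableEq ι] (μ : ι → Measure ℝ)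
    (hμ : ∀ i, IsProbabilityMeasure (μ i)) (l : ι) (ν : Measure ℝ) [IsProbabilityMeasure ν] :
    MeasurePreserving (fun p : (ι → ℝ) × ℝ => Function.update p.1 l p.2)
      ((Measure.pi μ).prod ν) (Measure.pi (Function.update μ l ν)) := by
  have hν : ∀ i, IsProbabilityMeasure (Function.update μ l ν i) := by
    intro i; by_cases h : i = l
    · subst h; simpa
    · simpa [h] using hμ i
  have hm : Measurable (fun p : (ι → ℝ) × ℝ => Function.update p.1 l p.2) := by
    rw [measurable_pi_iff]; intro i
    by_cases h : i = l
    · subst h; simpa using measurable_snd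
    · simp only [Function.update_of_ne h]; fun_prop
  refine ⟨hm, (Measure.pi_eq fun s hs => ?_).symm⟩
  rw [Measure.map_apply hm (MeasurableSet.univ_pi hs)]
  have : (fun p : (ι → ℝ) × ℝ => Function.update p.1 l p.2) ⁻¹' (Set.pi Set.univ s)
      = (Set.pi Set.univ (Function.update s l Set.univ)) ×ˢ s l := by
    ext ⟨x, t⟩
    simp only [Set.mem_preimage, Set.mem_pi, Set.mem_univ, true_imp_iff, Set.mem_prod]
    constructor
    · intro h
      refine ⟨fun i => ?_, by simpa using h l⟩
      by_cases hi : i = l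
      · subst hi; simp
      · simpa [hi] using h i
    · rintro ⟨h, ht⟩ i
      by_cases hi : i = l
      · subst hi; simpa
      · simpa [hi] using h i
  rw [this, Measure.prod_prod, Measure.pi_pi,
    ← Finset.mul_prod_erase Finset.univ _ (Finset.mem_univ l),
    ← Finset.mul_prod_erase Finset.univ (fun i => Function.update μ l ν i (s i))
      (Finset.mem_univ l)]
  simp only [Function.update_self, measure_univ, one_mul]
  rw [mul_comm]
  congr 1
  refine Finset.prod_congr rfl fun i hi => ?_
  have hi' := Finset.ne_of_mem_erase hi
  simp [hi']

theorem integral_resample {ι : Type} [Fintype ι] [DecidableEq ι] (μ : ι → Measure ℝ)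
    (hμ : ∀ i, IsProbabilityMeasure (μ i)) (l : ι) (ν : Measure ℝ) [IsProbabilityMeasure ν]
    {F : (ι → ℝ) → ℝ} (hF : Integrable F (Measure.pi (Function.update μ l ν))) :
    ∫ x, F x ∂(Measure.pi (Function.update μ l ν))
      = ∫ x, ∫ t, F (Function.update x l t) ∂ν ∂(Measure.pi μ) := by
  have h := measurePreserving_update μ hμ l ν
  have hF' := h.integrable_comp_of_integrable hF
  rw [← h.map_eq, integral_map h.measurable.aemeasurable
    (by rw [h.map_eq]; exact hF.aestronglyMeasurable)]
  exact integral_prod (fun p : (ι → ℝ) × ℝ => F (Function.update p.1 l p.2)) hF'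

theorem IsStd.integral_affine_sq {ν : Measure ℝ} (h : IsStd ν) (a b : ℝ) :
    ∫ t, (a + t * b) ^ 2 ∂ν = a ^ 2 + b ^ 2 := by
  have := h.prob
  have i1 := h.integrable_pow 1
  have m1 : ∫ t, t ^ 1 ∂ν = 0 := by simpa using h.moment_one
  have i2 := h.integrable_pow 2
  rw [show (fun t => (a + t * b) ^ 2) = fun t => a ^ 2 + ((2 * a * b) * t ^ 1 + b ^ 2 * t ^ 2) by
    ext t; ring]
  rw [integral_add (by fun_prop) (by fun_prop), integral_add (by fun_prop) (by fun_prop),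
    integral_const_mul, integral_const_mul, m1, h.moment_two]
  simp

theorem IsStd.integral_affine_four {ν : Measure ℝ} (h : IsStd ν) (a b : ℝ) :
    ∫ t, (a + t * b) ^ 4 ∂ν ≤ a ^ 4 + 6 * (a ^ 2 * b ^ 2) + 3 * b ^ 4 := by
  have := h.prob
  have i1 := h.integrable_pow 1
  have m1 : ∫ t, t ^ 1 ∂ν = 0 := by simpa using h.moment_one
  have i2 := h.integrable_pow 2
  have i3 := h.integrable_pow 3
  have i4 := h.integrable_pow 4
  rw [show (fun t => (a + t * b) ^ 4) = fun t => a ^ 4 + ((4 * a ^ 3 * b) * t ^ 1 +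
      ((6 * (a ^ 2 * b ^ 2)) * t ^ 2 + ((4 * a * b ^ 3) * t ^ 3 + b ^ 4 * t ^ 4))) by
    ext t; ring]
  rw [integral_add (by fun_prop) (by fun_prop), integral_add (by fun_prop) (by fun_prop),
    integral_add (by fun_prop) (by fun_prop), integral_add (by fun_prop) (by fun_prop),
    integral_const_mul, integral_const_mul, integral_const_mul, integral_const_mul,
    m1, h.moment_two, h.moment_three]
  simp
  nlinarith [mul_le_mul_of_nonneg_left h.moment_four (by positivity : 0 ≤ b ^ 4)]

theorem sq_integral_mul_le {Ω : Type} [MeasurableSpace Ω] {μ : Measure Ω} {U V : Ω → ℝ}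
    (hU : Integrable (fun x => U x ^ 2) μ) (hV : Integrable (fun x => V x ^ 2) μ)
    (hUV : Integrable (fun x => U x * V x) μ) :
    (∫ x, U x * V x ∂μ) ^ 2 ≤ (∫ x, U x ^ 2 ∂μ) * ∫ x, V x ^ 2 ∂μ := by
  have key : ∀ s : ℝ, 0 ≤ (∫ x, U x ^ 2 ∂μ) * (s * s) + (2 * ∫ x, U x * V x ∂μ) * s
      + ∫ x, V x ^ 2 ∂μ := by
    intro s
    have : 0 ≤ ∫ x, (s * U x + V x) ^ 2 ∂μ := integral_nonneg fun x => sq_nonneg _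
    rw [show (fun x => (s * U x + V x) ^ 2) = fun x => (s * s) * U x ^ 2 +
      ((2 * s) * (U x * V x) + V x ^ 2) by ext x; ring] at this
    rw [integral_add (by fun_prop) (by fun_prop), integral_add (by fun_prop) (by fun_prop),
      integral_const_mul, integral_const_mul] at this
    linarith
  have := discrim_le_zero key
  unfold discrim at this
  nlinarith

/-- Second moments of multilinear polynomials under products of standardized laws. -/
theorem integral_mev_sq {ι : Type} [Fintype ι] {μ : ι → Measure ℝ} (hμ : ∀ i, IsStd (μ i))
    (f : Finset ι → ℝ) : ∫ x, mev f x ^ 2 ∂(Measure.pi μ) = ∑ S, f S ^ 2 := by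
  have hp := fun i => (hμ i).prob
  suffices h : ∀ (T : Finset ι) (f : Finset ι → ℝ), (∀ S, ¬ S ⊆ T → f S = 0) →
      ∫ x, mev f x ^ 2 ∂(Measure.pi μ) = ∑ S, f S ^ 2 from
    h Finset.univ f fun S hS => absurd (Finset.subset_univ S) hS
  intro T
  induction T using Finset.induction_on with
  | empty =>
    intro f hf
    have h0 : ∀ S, S ≠ ∅ → f S = 0 := fun S hS => hf S (by simpa using hS)
    have h1 : ∀ x, mev f x = f ∅ := fun x => by
      unfold mev
      rw [Finset.sum_eq_single ∅ (fun S _ hS => by simp [h0 S hS]) (by simp)]; simp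
    rw [Finset.sum_eq_single ∅ (fun S _ hS => by simp [h0 S hS]) (by simp)]
    simp [h1]
  | insert l T hl ih =>
    intro f hf
    have ha := ih (mfree l f) (fun S hS => by
      unfold mfree; split_ifs with h
      · rfl
      · refine hf S fun h2 => hS fun i hi => ?_
        have := h2 hi
        rw [Finset.mem_insert] at this
        rcases this with rfl | h3
        · exact absurd hi h
        · exact h3)
    have hb := ih (mder l f) (fun S hS => by
      unfold mder; split_ifs with h
      · rfl
      · refine hf _ fun h2 => hS fun i hi => ?_
        have := h2 (Finset.mem_insert_of_mem hi)
        rw [Finset.mem_insert] at this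
        rcases this with rfl | h3
        · exact absurd hi h
        · exact h3)
    have e : Measure.pi μ = Measure.pi (Function.update μ l (μ l)) := by simp
    have hi : Integrable (fun x => mev f x ^ 2) (Measure.pi (Function.update μ l (μ l))) := by
      rw [← e]; exact ((isPoly_mev f).pow 2).integrable hμ
    rw [e, integral_resample μ hp l (μ l) hi]
    simp_rw [mev_update, (hμ l).integral_affine_sq]
    rw [integral_add (((isPoly_mev _).pow 2).integrable hμ)
      (((isPoly_mev _).pow 2).integrable hμ), ha, hb]
    have := sum_weight_split l f 1
    simp at this
    exact this.symm

/-- Fourth moment hypercontractivity for products of standardized laws. -/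
theorem integral_mev_four_le {ι : Type} [Fintype ι] {μ : ι → Measure ℝ}
    (hμ : ∀ i, IsStd (μ i)) (f : Finset ι → ℝ) :
    ∫ x, mev f x ^ 4 ∂(Measure.pi μ) ≤ (∑ S, 3 ^ S.card * f S ^ 2) ^ 2 := by
  have hp := fun i => (hμ i).prob
  suffices h : ∀ (T : Finset ι) (f : Finset ι → ℝ), (∀ S, ¬ S ⊆ T → f S = 0) →
      ∫ x, mev f x ^ 4 ∂(Measure.pi μ) ≤ (∑ S, 3 ^ S.card * f S ^ 2) ^ 2 from
    h Finset.univ f fun S hS => absurd (Finset.subset_univ S) hS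
  intro T
  induction T using Finset.induction_on with
  | empty =>
    intro f hf
    have h0 : ∀ S, S ≠ ∅ → f S = 0 := fun S hS => hf S (by simpa using hS)
    have h1 : ∀ x, mev f x = f ∅ := fun x => by
      unfold mev
      rw [Finset.sum_eq_single ∅ (fun S _ hS => by simp [h0 S hS]) (by simp)]; simp
    rw [Finset.sum_eq_single ∅ (fun S _ hS => by simp [h0 S hS]) (by simp)]
    simp [h1]
    apply le_of_eq; ring
  | insert l T hl ih =>
    intro f hf
    have ha := ih (mfree l f) (fun S hS => by
      unfold mfree; split_ifs with h
      · rfl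
      · refine hf S fun h2 => hS fun i hi => ?_
        have := h2 hi
        rw [Finset.mem_insert] at this
        rcases this with rfl | h3
        · exact absurd hi h
        · exact h3)
    have hb := ih (mder l f) (fun S hS => by
      unfold mder; split_ifs with h
      · rfl
      · refine hf _ fun h2 => hS fun i hi => ?_
        have := h2 (Finset.mem_insert_of_mem hi)
        rw [Finset.mem_insert] at this
        rcases this with rfl | h3
        · exact absurd hi h
        · exact h3)
    have e : Measure.pi μ = Measure.pi (Function.update μ l (μ l)) := by simp
    have hi : Integrable (fun x => mev f x ^ 4) (Measure.pi (Function.update μ l (μ l))) := by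
      rw [← e]; exact ((isPoly_mev f).pow 4).integrable hμ
    rw [e, integral_resample μ hp l (μ l) hi]
    simp_rw [mev_update]
    set A := mev (mfree l f)
    set B := mev (mder l f)
    have pA : IsPoly A := isPoly_mev _
    have pB : IsPoly B := isPoly_mev _
    set a := ∑ S, 3 ^ S.card * mfree l f S ^ 2
    set b := ∑ S, 3 ^ S.card * mder l f S ^ 2
    have a0 : 0 ≤ a := Finset.sum_nonneg fun _ _ => by positivity
    have b0 : 0 ≤ b := Finset.sum_nonneg fun _ _ => by positivity
    have iA := (pA.pow 4).integrable hμ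
    have iB := (pB.pow 4).integrable hμ
    have iAB := ((pA.pow 2).mul (pB.pow 2)).integrable hμ
    have cs : (∫ x, A x ^ 2 * B x ^ 2 ∂(Measure.pi μ)) ^ 2
        ≤ (∫ x, A x ^ 4 ∂(Measure.pi μ)) * ∫ x, B x ^ 4 ∂(Measure.pi μ) := by
      have := sq_integral_mul_le (μ := Measure.pi μ) (U := fun x => A x ^ 2)
        (V := fun x => B x ^ 2) (by simpa [← pow_mul] using iA) (by simpa [← pow_mul] using iB)
        iAB
      simpa [← pow_mul] using this
    have hm : ∫ x, A x ^ 2 * B x ^ 2 ∂(Measure.pi μ) ≤ a * b := by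
      refine le_of_sq_le_sq ?_ (mul_nonneg a0 b0)
      calc _ ≤ _ := cs
        _ ≤ a ^ 2 * b ^ 2 := mul_le_mul ha hb (integral_nonneg fun x => by positivity)
          (by positivity)
        _ = _ := by ring
    calc ∫ x, ∫ t, (A x + t * B x) ^ 4 ∂(μ l) ∂(Measure.pi μ)
        ≤ ∫ x, (A x ^ 4 + 6 * (A x ^ 2 * B x ^ 2) + 3 * B x ^ 4) ∂(Measure.pi μ) := by
          refine integral_mono_of_nonneg (Filter.Eventually.of_forall fun x =>
            integral_nonneg fun t => by positivity) (by fun_prop)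
            (Filter.Eventually.of_forall fun x => (hμ l).integral_affine_four _ _)
      _ = ∫ x, A x ^ 4 ∂(Measure.pi μ) + 6 * ∫ x, A x ^ 2 * B x ^ 2 ∂(Measure.pi μ)
          + 3 * ∫ x, B x ^ 4 ∂(Measure.pi μ) := by
          rw [integral_add (by fun_prop) (by fun_prop), integral_add (by fun_prop) (by fun_prop),
            integral_const_mul, integral_const_mul]
      _ ≤ a ^ 2 + 6 * (a * b) + 3 * b ^ 2 := by linarith
      _ ≤ (a + 3 * b) ^ 2 := by nlinarith [sq_nonneg b]
      _ = _ := by rw [sum_weight_split l f 3]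

theorem integral_pow_three_gaussianReal : ∫ x, x ^ 3 ∂(gaussianReal 0 1) = 0 := by
  have h : ∫ x, x ^ 3 ∂((gaussianReal 0 1).map fun x => -x)
      = ∫ x, (-x) ^ 3 ∂(gaussianReal 0 1) :=
    integral_map (by fun_prop) (by fun_prop)
  rw [gaussianReal_map_neg, neg_zero] at h
  simp_rw [Odd.neg_pow (by decide : Odd 3)] at h
  rw [integral_neg] at h
  linarith

theorem hasDerivAt_poly_mul_exp (P Q : ℝ → ℝ) (t : ℝ) (h : HasDerivAt P (Q t - t * P t) t) :
    HasDerivAt (fun t => P t * Real.exp (t ^ 2 / 2)) (Q t * Real.exp (t ^ 2 / 2)) t := by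
  have h2 : HasDerivAt (fun t : ℝ => t ^ 2 / 2) t t := by
    have := (hasDerivAt_pow 2 t).div_const 2
    simpa using this
  convert! h.mul h2.exp using 1
  ring

theorem integral_pow_four_gaussianReal : ∫ x, x ^ 4 ∂(gaussianReal 0 1) = 3 := by
  have h := iteratedDeriv_mgf_zero (X := fun x : ℝ => x) (μ := gaussianReal 0 1) (by simp) 4
  simp only [Pi.pow_apply] at h
  rw [← h, mgf_fun_id_gaussianReal]
  have e0 : (fun t : ℝ => Real.exp (0 * t + (1 : NNReal) * t ^ 2 / 2))
      = fun t => 1 * Real.exp (t ^ 2 / 2) := by ext t; simp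
  have e1 : deriv (fun t : ℝ => 1 * Real.exp (t ^ 2 / 2)) = fun t => t * Real.exp (t ^ 2 / 2) := by
    ext t
    refine (hasDerivAt_poly_mul_exp (fun _ => 1) (fun t => t) t ?_).deriv
    simpa using hasDerivAt_const t (1 : ℝ)
  have e2 : deriv (fun t : ℝ => t * Real.exp (t ^ 2 / 2))
      = fun t => (1 + t ^ 2) * Real.exp (t ^ 2 / 2) := by
    ext t
    refine (hasDerivAt_poly_mul_exp (fun t => t) (fun t => 1 + t ^ 2) t ?_).deriv
    convert! hasDerivAt_id t using 1; ring
  have e3 : deriv (fun t : ℝ => (1 + t ^ 2) * Real.exp (t ^ 2 / 2))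
      = fun t => (3 * t + t ^ 3) * Real.exp (t ^ 2 / 2) := by
    ext t
    refine (hasDerivAt_poly_mul_exp (fun t => 1 + t ^ 2) (fun t => 3 * t + t ^ 3) t ?_).deriv
    convert! (hasDerivAt_pow 2 t).const_add 1 using 1; simp; ring
  have e4 : deriv (fun t : ℝ => (3 * t + t ^ 3) * Real.exp (t ^ 2 / 2))
      = fun t => (3 + 6 * t ^ 2 + t ^ 4) * Real.exp (t ^ 2 / 2) := by
    ext t
    refine (hasDerivAt_poly_mul_exp (fun t => 3 * t + t ^ 3)
      (fun t => 3 + 6 * t ^ 2 + t ^ 4) t ?_).deriv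
    convert! ((hasDerivAt_id t).const_mul 3).add (hasDerivAt_pow 3 t) using 1; simp; ring
  rw [e0, iteratedDeriv_succ', iteratedDeriv_succ', iteratedDeriv_succ', iteratedDeriv_succ',
    e1, e2, e3, e4, iteratedDeriv_zero]
  simp

theorem isStd_gaussianReal : IsStd (gaussianReal 0 1) where
  prob := inferInstance
  integrable_pow k := by
    have := (memLp_id_gaussianReal (μ := 0) (v := 1) (k : NNReal)).integrable_norm_pow'
    refine (integrable_norm_iff (by fun_prop)).1 ?_
    simpa using this
  moment_one := by simp
  moment_two := by
    have h := variance_fun_id_gaussianReal (μ := 0) (v := 1)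
    rw [variance_of_integral_eq_zero (by fun_prop) (by simp)] at h
    simpa using h
  moment_three := integral_pow_three_gaussianReal
  moment_four := integral_pow_four_gaussianReal.le

/-- The uniform law on `{-1, 1}`. -/
noncomputable def rad : Measure ℝ :=
  (2⁻¹ : ENNReal) • (Measure.dirac 1 + Measure.dirac (-1))

theorem integral_rad (F : ℝ → ℝ) : ∫ t, F t ∂rad = (F 1 + F (-1)) / 2 := by
  unfold rad
  rw [integral_smul_measure, integral_add_measure, integral_dirac, integral_dirac]
  · simp; ring
  all_goals exact integrable_dirac (by simp)

theorem isStd_rad : IsStd rad where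
  prob := ⟨by
    simp only [rad, Measure.smul_apply, Measure.add_apply, measure_univ, smul_eq_mul]
    rw [one_add_one_eq_two]; exact ENNReal.inv_mul_cancel (by simp) (by simp)⟩
  integrable_pow k := by
    refine Integrable.smul_measure ?_ (by simp)
    exact (integrable_dirac (by simp)).add_measure (integrable_dirac (by simp))
  moment_one := by rw [integral_rad]; norm_num
  moment_two := by rw [integral_rad]; norm_num
  moment_three := by rw [integral_rad]; norm_num
  moment_four := by rw [integral_rad]; norm_num

instance : IsProbabilityMeasure rad := isStd_rad.prob

theorem rad_apply (s : Set ℝ) (hs : MeasurableSet s) :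
    rad s = ∑ b : Bool, 2⁻¹ * (if (if b then (1 : ℝ) else -1) ∈ s then 1 else 0) := by
  unfold rad
  simp [hs, Set.indicator_apply]

/-- `bprob` is the probability under the product of the uniform laws on `{-1, 1}`. -/
theorem bprob_eq (n : ℕ) (P : (Fin n → ℝ) → Prop) (hP : MeasurableSet {x | P x}) :
    bprob n P = (Measure.pi fun _ : Fin n => rad).real {x | P x} := by
  have key : (Measure.pi fun _ : Fin n => rad)
      = ((2 : ENNReal)⁻¹ ^ n) •
        ∑ b : Fin n → Bool, Measure.dirac fun i => if b i then (1 : ℝ) else -1 := by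
    refine Measure.pi_eq fun s hs => ?_
    simp_rw [rad_apply _ (hs _)]
    rw [Finset.prod_univ_sum]
    simp only [Measure.smul_apply, Measure.finsetSum_apply, smul_eq_mul, Fintype.piFinset_univ]
    rw [Finset.mul_sum]
    refine Finset.sum_congr rfl fun b _ => ?_
    rw [Finset.prod_mul_distrib, Measure.dirac_apply' _ (MeasurableSet.univ_pi hs)]
    simp only [Finset.prod_const, Finset.card_univ, Fintype.card_fin]
    congr 1
    rw [Set.indicator_apply, Finset.prod_ite_zero]
    simp [Set.mem_pi]
  unfold bprob Measure.real
  rw [key]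
  simp only [Measure.smul_apply, Measure.finsetSum_apply, smul_eq_mul,
    Measure.dirac_apply' _ hP, Set.indicator_apply, Set.mem_ofPred_eq, Pi.one_apply]
  rw [Finset.sum_boole]
  simp
  rw [div_eq_inv_mul]

/-- The standard Gaussian measure on `ι → ℝ`. -/
noncomputable def gam (ι : Type) [Fintype ι] : Measure (ι → ℝ) :=
  Measure.pi fun _ => gaussianReal 0 1

instance (ι : Type) [Fintype ι] : IsProbabilityMeasure (gam ι) := by
  unfold gam; infer_instance

theorem isGaussian_gam (ι : Type) [Fintype ι] : IsGaussian (gam ι) := by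
  have h := map_pi_eq_stdGaussian (ι := ι)
  have h2 : Measure.map (EuclideanSpace.equiv ι ℝ).toContinuousLinearMap
      (ProbabilityTheory.stdGaussian (EuclideanSpace ℝ ι)) = gam ι := by
    rw [← h, Measure.map_map (by fun_prop) (by fun_prop)]
    exact Measure.map_id
  rw [← h2]; infer_instance

theorem map_rotation_gam (ι : Type) [Fintype ι] (θ : ℝ) :
    ((gam ι).prod (gam ι)).map (ContinuousLinearMap.rotation θ) = (gam ι).prod (gam ι) := by
  have := isGaussian_gam ι
  refine IsGaussian.map_rotation_eq_self_of_forall_strongDual_eq_zero (fun L => ?_) θ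
  have hL : ∀ x : ι → ℝ, L x = ∑ i, x i * L (Pi.single i 1) := by
    intro x
    conv_lhs => rw [← Finset.univ_sum_single x]
    rw [map_sum]
    refine Finset.sum_congr rfl fun i _ => ?_
    rw [← smul_eq_mul, ← map_smul, ← Pi.single_smul, smul_eq_mul, mul_one]
  have hc : ∀ i, ∫ x, x i ∂(gam ι) = 0 := fun i => by
    have := integral_comp_eval (μ := fun _ : ι => gaussianReal 0 1) (i := i)
      (f := fun t : ℝ => t) (by fun_prop)
    unfold gam
    rw [this]; simp
  have hi : ∀ i, Integrable (fun x : ι → ℝ => x i) (gam ι) := fun i =>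
    (IsPoly.coord i).integrable fun _ => isStd_gaussianReal
  rw [integral_congr_ae (Filter.Eventually.of_forall hL)]
  rw [integral_finsetSum _ fun i _ => (hi i).mul_const _]
  simp [integral_mul_const, hc]

theorem abs_sub_le_norm_exp_sub {θ φ : ℝ} (h : |θ - φ| ≤ 1) :
    |θ - φ| ≤ 2 * ‖Complex.exp (θ * Complex.I) - Complex.exp (φ * Complex.I)‖ := by
  have e : Complex.exp (θ * Complex.I) - Complex.exp (φ * Complex.I)
      = Complex.exp (φ * Complex.I) * (Complex.exp (Complex.I * (θ - φ : ℝ)) - 1) := by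
    rw [mul_sub, ← Complex.exp_add]; push_cast; ring_nf
  rw [e, norm_mul, Complex.norm_exp_ofReal_mul_I, one_mul, Complex.norm_exp_I_mul_ofReal_sub_one,
    Real.norm_eq_abs, abs_mul, abs_two]
  have hpi : |(θ - φ) / 2| ≤ Real.pi / 2 := by
    rw [abs_div, abs_two]; have := Real.pi_gt_three; linarith
  have h1 := Real.mul_abs_le_abs_sin hpi
  rw [abs_div, abs_two] at h1
  have h2 : (1 : ℝ) / 2 ≤ 2 / Real.pi := by
    rw [div_le_div_iff₀ (by norm_num) Real.pi_pos]; linarith [Real.pi_le_four]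
  nlinarith [abs_nonneg (θ - φ)]

theorem volume_near_le (z : ℂ) (η : ℝ) :
    volume {θ : ℝ | θ ∈ Set.Icc 0 1 ∧ ‖Complex.exp (θ * Complex.I) - z‖ < η}
      ≤ ENNReal.ofReal (8 * η) := by
  rcases Set.eq_empty_or_nonempty
    {θ : ℝ | θ ∈ Set.Icc 0 1 ∧ ‖Complex.exp (θ * Complex.I) - z‖ < η} with h | ⟨φ, hφ, hφz⟩
  · rw [h]; simp
  · refine (measure_mono (t := Set.Icc (φ - 4 * η) (φ + 4 * η)) ?_).trans ?_
    · rintro θ ⟨hθ, hθz⟩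
      have h1 : |θ - φ| ≤ 1 := by
        rw [abs_le]; constructor <;> linarith [hθ.1, hθ.2, hφ.1, hφ.2]
      have h2 := abs_sub_le_norm_exp_sub h1
      have h3 := norm_sub_le_norm_sub_add_norm_sub (Complex.exp (θ * Complex.I)) z
        (Complex.exp (φ * Complex.I))
      rw [norm_sub_rev z] at h3
      have := abs_le.1 (h2.trans (by linarith : _ ≤ 4 * η))
      constructor <;> linarith
    · rw [Real.volume_Icc]; exact ENNReal.ofReal_le_ofReal (by linarith)

/-- A real trigonometric polynomial of degree `d` is rarely small compared to its derivative. -/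
theorem volume_trig_small (d : ℕ) (q q' : ℝ → ℝ) (hq : ∀ θ, HasDerivAt q (q' θ) θ)
    (R : Polynomial ℂ) (hR : R.natDegree ≤ 2 * d)
    (hRq : ∀ θ : ℝ, R.eval (Complex.exp (θ * Complex.I))
      = Complex.exp (d * (θ * Complex.I)) * q θ) {ε : ℝ} (hε : 0 < ε) :
    volume {θ : ℝ | θ ∈ Set.Icc 0 1 ∧ |q θ| < ε * |q' θ|}
      ≤ ENNReal.ofReal (64 * (d + 1) ^ 2 * ε) := by
  by_cases hd : 1 / 2 < ε * d
  · refine (measure_mono (t := Set.Icc 0 1) fun θ hθ => hθ.1).trans ?_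
    rw [Real.volume_Icc]
    refine ENNReal.ofReal_le_ofReal ?_
    nlinarith [mul_nonneg hε.le (sq_nonneg (d : ℝ))]
  push Not at hd
  set η := 4 * (d + 1) * ε with hη
  have hη0 : 0 < η := by positivity
  have hn : ∀ θ : ℝ, ‖Complex.exp (θ * Complex.I)‖ = 1 := Complex.norm_exp_ofReal_mul_I
  have hn' : ∀ θ : ℝ, ‖Complex.exp (d * (θ * Complex.I))‖ = 1 := fun θ => by
    rw [Complex.exp_nat_mul, norm_pow, hn, one_pow]
  have hRn : ∀ θ : ℝ, ‖R.eval (Complex.exp (θ * Complex.I))‖ = |q θ| := fun θ => by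
    rw [hRq, norm_mul, hn', one_mul, Complex.norm_real, Real.norm_eq_abs]
  have hder : ∀ θ : ℝ, |q' θ| ≤ ‖R.derivative.eval (Complex.exp (θ * Complex.I))‖ + d * |q θ| := by
    intro θ
    have he : HasDerivAt (fun θ : ℝ => Complex.exp (θ * Complex.I))
        (Complex.exp (θ * Complex.I) * Complex.I) θ := by
      have := ((Complex.ofRealCLM.hasDerivAt (x := θ)).mul_const Complex.I).cexp
      simpa using this
    have he' : HasDerivAt (fun θ : ℝ => Complex.exp (d * (θ * Complex.I)))
        (Complex.exp (d * (θ * Complex.I)) * (d * Complex.I)) θ := by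
      have := (((Complex.ofRealCLM.hasDerivAt (x := θ)).mul_const Complex.I).const_mul
        (d : ℂ)).cexp
      simpa using this
    have h1 := (R.hasDerivAt (Complex.exp (θ * Complex.I))).comp_of_eq θ he rfl
    have h2 := he'.mul (hq θ).ofReal_comp
    have h3 := h1.unique (h2.congr_of_eventuallyEq (Filter.Eventually.of_forall hRq))
    have h4 : Complex.exp (d * (θ * Complex.I)) * (q' θ : ℂ)
        = R.derivative.eval (Complex.exp (θ * Complex.I)) * (Complex.exp (θ * Complex.I) * Complex.I)
          - Complex.exp (d * (θ * Complex.I)) * (d * Complex.I) * q θ := by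
      rw [h3]; ring
    have h5 := congrArg norm h4
    rw [norm_mul, hn', one_mul, Complex.norm_real, Real.norm_eq_abs] at h5
    rw [h5]
    refine (norm_sub_le _ _).trans (le_of_eq ?_)
    simp only [norm_mul, hn, hn', Complex.norm_I, Complex.norm_real, Real.norm_eq_abs,
      Complex.norm_natCast]
    ring
  have hsub : {θ : ℝ | θ ∈ Set.Icc 0 1 ∧ |q θ| < ε * |q' θ|}
      ⊆ ⋃ z ∈ R.roots.toFinset,
        {θ : ℝ | θ ∈ Set.Icc 0 1 ∧ ‖Complex.exp (θ * Complex.I) - z‖ < η} := by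
    rintro θ ⟨hθ, hlt⟩
    simp only [Set.mem_iUnion]
    by_contra hcon
    push Not at hcon
    have hfar : ∀ z ∈ R.roots, η ≤ ‖Complex.exp (θ * Complex.I) - z‖ := fun z hz => by
      by_contra h; exact hcon z (by simpa using hz) ⟨hθ, not_le.1 h⟩
    have hq0 : 0 < |q' θ| := by
      by_contra h
      have : |q' θ| = 0 := le_antisymm (not_lt.1 h) (abs_nonneg _)
      rw [this, mul_zero] at hlt
      exact absurd hlt (not_lt.2 (abs_nonneg _))
    have hR0 : R ≠ 0 := by
      rintro rfl
      have h0 : ∀ φ, q φ = 0 := fun φ => by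
        have := hRn φ; simpa using this.symm
      have : q = fun _ => (0 : ℝ) := funext h0
      have h1 := hq θ
      rw [this] at h1
      have := h1.unique (hasDerivAt_const θ 0)
      rw [this] at hq0; simp at hq0
    set e := Complex.exp (θ * Complex.I)
    have hRe : R.eval e ≠ 0 := fun h => by
      have := hfar e ((Polynomial.mem_roots hR0).2 h)
      simp at this; linarith
    have hlog := (IsAlgClosed.splits R).eval_derivative_div_eval_of_ne_zero hRe
    have hb : ‖R.derivative.eval e / R.eval e‖ ≤ 2 * d * η⁻¹ := by
      rw [hlog]
      refine (norm_multiset_sum_le _).trans ?_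
      rw [Multiset.map_map]
      refine (Multiset.sum_le_card_nsmul _ η⁻¹ ?_).trans ?_
      · intro y hy
        obtain ⟨z, hz, rfl⟩ := Multiset.mem_map.1 hy
        simp only [Function.comp, one_div, norm_inv]
        exact inv_anti₀ hη0 (hfar z hz)
      · rw [nsmul_eq_mul, Multiset.card_map]
        gcongr
        exact_mod_cast (Polynomial.card_roots' R).trans hR
    rw [norm_div, hRn, div_le_iff₀ (by rw [← hRn]; exact norm_pos_iff.2 hRe)] at hb
    have h6 := hder θ
    have h7 : 2 * d * η⁻¹ * |q θ| ≤ 2 * d * η⁻¹ * (ε * |q' θ|) := by gcongr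
    have h8 : 2 * d * η⁻¹ * (ε * |q' θ|) = (d / (2 * (d + 1))) * |q' θ| := by
      rw [hη]; field_simp; ring
    have h9 : (d : ℝ) * |q θ| ≤ 1 / 2 * |q' θ| := by nlinarith [abs_nonneg (q θ)]
    have h10 : (d : ℝ) / (2 * (d + 1)) < 1 / 2 := by
      rw [div_lt_div_iff₀ (by positivity) (by norm_num)]; linarith
    nlinarith
  refine (measure_mono hsub).trans ((measure_biUnion_finset_le _ _).trans ?_)
  refine (Finset.sum_le_card_nsmul _ _ _ fun z _ => volume_near_le z η).trans ?_
  rw [nsmul_eq_mul, ← ENNReal.ofReal_natCast, ← ENNReal.ofReal_mul (by positivity)]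
  refine ENNReal.ofReal_le_ofReal ?_
  have hc : (R.roots.toFinset.card : ℝ) ≤ 2 * d := by
    exact_mod_cast (R.roots.toFinset_card_le).trans ((Polynomial.card_roots' R).trans hR)
  calc (R.roots.toFinset.card : ℝ) * (8 * η) ≤ 2 * d * (8 * η) := by gcongr
    _ ≤ 64 * (d + 1) ^ 2 * ε := by rw [hη]; nlinarith [mul_nonneg (Nat.cast_nonneg (α := ℝ) d) hε.le]

theorem hasDerivAt_mev {ι : Type} [Fintype ι] [DecidableEq ι] (f : Finset ι → ℝ)
    (u : ℝ → ι → ℝ) (u' : ι → ℝ) (θ : ℝ) (hu : ∀ i, HasDerivAt (fun θ => u θ i) (u' i) θ) :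
    HasDerivAt (fun θ => mev f (u θ)) (∑ l, u' l * mev (mder l f) (u θ)) θ := by
  have h := HasDerivAt.fun_sum (u := (Finset.univ : Finset (Finset ι)))
    (A := fun S θ => f S * ∏ i ∈ S, u θ i) fun S _ =>
      (HasDerivAt.fun_finsetProd (u := S) fun i _ => hu i).const_mul (f S)
  refine h.congr_deriv ?_
  have e : ∀ l, mev (mder l f) (u θ)
      = ∑ S, if l ∈ S then f S * ∏ i ∈ S.erase l, u θ i else 0 := by
    intro l
    rw [← sum_insert_eq l fun S => f S * ∏ i ∈ S.erase l, u θ i]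
    refine Finset.sum_congr rfl fun S _ => ?_
    unfold mder
    split_ifs with hl
    · simp
    · rw [Finset.erase_insert hl]
  simp_rw [e, Finset.mul_sum]
  rw [Finset.sum_comm]
  refine Finset.sum_congr rfl fun S _ => ?_
  simp only [mul_ite, mul_zero]
  rw [← Finset.sum_filter]
  simp only [Finset.filter_mem_eq_inter, Finset.univ_inter, smul_eq_mul]
  exact Finset.sum_congr rfl fun l _ => by ring

theorem volume_mev_rotation_small {ι : Type} [Fintype ι] [DecidableEq ι] (d : ℕ)
    (f : Finset ι → ℝ) (hf : ∀ S, d < S.card → f S = 0) (x y : ι → ℝ) {ε : ℝ} (hε : 0 < ε) :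
    volume {θ : ℝ | θ ∈ Set.Icc 0 1 ∧ |mev f (Real.cos θ • x + Real.sin θ • y)|
        < ε * |∑ l, (-Real.sin θ • x + Real.cos θ • y) l
          * mev (mder l f) (Real.cos θ • x + Real.sin θ • y)|}
      ≤ ENNReal.ofReal (64 * (d + 1) ^ 2 * ε) := by
  let T : ι → Polynomial ℂ := fun i =>
    Polynomial.C ((x i - y i * Complex.I) / 2) * Polynomial.X ^ 2
      + Polynomial.C ((x i + y i * Complex.I) / 2)
  have hT : ∀ i (θ : ℝ), (T i).eval (Complex.exp (θ * Complex.I))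
      = Complex.exp (θ * Complex.I) * ((Real.cos θ • x + Real.sin θ • y) i : ℝ) := by
    intro i θ
    have h1 := Complex.cos_sq_add_sin_sq (θ : ℂ)
    simp only [T, Polynomial.eval_add, Polynomial.eval_mul, Polynomial.eval_C,
      Polynomial.eval_pow, Polynomial.eval_X, Complex.exp_mul_I, Pi.add_apply, Pi.smul_apply,
      smul_eq_mul]
    push_cast
    have h2 := Complex.I_sq
    generalize Complex.cos θ = a at *
    generalize Complex.sin θ = b at *
    linear_combination (-(x i + y i * Complex.I) / 2) * h1
      + ((x i - y i * Complex.I) / 2 * b ^ 2 - y i * a * b + (x i + y i * Complex.I) / 2 * 0) * h2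
  refine volume_trig_small d _ _ (fun θ => hasDerivAt_mev f _ _ θ fun i => ?_)
    (∑ S, Polynomial.C (f S : ℂ) * Polynomial.X ^ (d - S.card) * ∏ i ∈ S, T i) ?_ ?_ hε
  · simp only [Pi.add_apply, Pi.smul_apply, smul_eq_mul]
    exact ((Real.hasDerivAt_cos θ).mul_const _).add ((Real.hasDerivAt_sin θ).mul_const _)
  · refine Polynomial.natDegree_sum_le_of_forall_le _ _ fun S _ => ?_
    by_cases hS : d < S.card
    · simp [hf S hS]
    · have h1 : (∏ i ∈ S, T i).natDegree ≤ S.card * 2 := by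
        refine (Polynomial.natDegree_prod_le _ _).trans ?_
        refine (Finset.sum_le_card_nsmul _ _ 2 fun i _ => ?_).trans (by simp)
        exact Polynomial.natDegree_add_C.le.trans (Polynomial.natDegree_C_mul_X_pow_le _ _)
      have h2 := Polynomial.natDegree_mul_le
        (p := Polynomial.C (f S : ℂ) * Polynomial.X ^ (d - S.card)) (q := ∏ i ∈ S, T i)
      have h3 := Polynomial.natDegree_C_mul_X_pow_le (f S : ℂ) (d - S.card)
      omega
  · intro θ
    rw [Polynomial.eval_finsetSum]
    unfold mev
    push_cast
    rw [Finset.mul_sum]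
    refine Finset.sum_congr rfl fun S _ => ?_
    by_cases hS : d < S.card
    · simp [hf S hS]
    · have e : Complex.exp (d * (θ * Complex.I))
          = Complex.exp (θ * Complex.I) ^ (d - S.card) * Complex.exp (θ * Complex.I) ^ S.card := by
        rw [← pow_add, Nat.sub_add_cancel (not_lt.1 hS), Complex.exp_nat_mul]
      simp only [Polynomial.eval_mul, Polynomial.eval_C, Polynomial.eval_pow, Polynomial.eval_X,
        Polynomial.eval_prod, hT, Finset.prod_mul_distrib, Finset.prod_const, e]
      ring

/-- A polynomial is rarely small compared to its derivative in a random Gaussian direction. -/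
theorem gam_prod_small {ι : Type} [Fintype ι] [DecidableEq ι] (d : ℕ)
    (f : Finset ι → ℝ) (hf : ∀ S, d < S.card → f S = 0) {ε : ℝ} (hε : 0 < ε) :
    ((gam ι).prod (gam ι)) {p | |mev f p.1| < ε * |∑ l, p.2 l * mev (mder l f) p.1|}
      ≤ ENNReal.ofReal (64 * (d + 1) ^ 2 * ε) := by
  set A : Set ((ι → ℝ) × (ι → ℝ)) :=
    {p | |mev f p.1| < ε * |∑ l, p.2 l * mev (mder l f) p.1|} with hA
  have hc : ∀ g : Finset ι → ℝ, Continuous (mev g) := fun g => (isPoly_mev g).continuous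
  have hAm : MeasurableSet A := by
    refine (isOpen_lt ?_ ?_).measurableSet
    · exact ((hc f).comp continuous_fst).abs
    · refine continuous_const.mul (Continuous.abs ?_)
      exact continuous_finsetSum _ fun l _ =>
        ((continuous_apply l).comp continuous_snd).mul ((hc _).comp continuous_fst)
  let B : Set (ℝ × ((ι → ℝ) × (ι → ℝ))) :=
    (fun z => (Real.cos z.1 • z.2.1 + Real.sin z.1 • z.2.2,
      -Real.sin z.1 • z.2.1 + Real.cos z.1 • z.2.2)) ⁻¹' A
  have hBm : MeasurableSet B := hAm.preimage (by fun_prop)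
  have h1 : ∀ θ : ℝ, ((gam ι).prod (gam ι)) (Prod.mk θ ⁻¹' B) = ((gam ι).prod (gam ι)) A := by
    intro θ
    conv_rhs => rw [← map_rotation_gam ι θ]
    rw [Measure.map_apply (by fun_prop) hAm]
    congr 1
  have h2 : ((volume.restrict (Set.Icc (0 : ℝ) 1)).prod ((gam ι).prod (gam ι))) B
      = ((gam ι).prod (gam ι)) A := by
    rw [Measure.prod_apply hBm]
    simp [h1]
  rw [← h2, Measure.prod_apply_symm hBm]
  refine (lintegral_mono (g := fun _ => ENNReal.ofReal (64 * (d + 1) ^ 2 * ε))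
    fun p => ?_).trans (by simp)
  rw [Measure.restrict_apply' measurableSet_Icc]
  refine (measure_mono ?_).trans (volume_mev_rotation_small d f hf p.1 p.2 hε)
  rintro θ ⟨h, hθ⟩
  exact ⟨hθ, h⟩

theorem sum_extend {α β : Type} [Fintype α] [Fintype β] (e : α → β)
    (he : Function.Injective e) (c : α → ℝ) (F : β → ℝ → ℝ) (hF : ∀ S, F S 0 = 0) :
    ∑ S, F S (Function.extend e c 0 S) = ∑ a, F (e a) (c a) := by
  symm
  refine Fintype.sum_of_injective e he _ _ (fun S hS => ?_) fun a => ?_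
  · rw [Function.extend_apply' _ _ _ fun ⟨a, ha⟩ => hS ⟨a, ha⟩]; exact hF S
  · rw [he.extend_apply]

theorem mev_extend {α ι : Type} [Fintype α] [Fintype ι] (e : α → Finset ι)
    (he : Function.Injective e) (c : α → ℝ) (x : ι → ℝ) :
    mev (Function.extend e c 0) x = ∑ a, c a * ∏ i ∈ e a, x i :=
  sum_extend e he c (fun S t => t * ∏ i ∈ S, x i) fun _ => zero_mul _

/-- A random Gaussian combination of a vector is not much larger than the corresponding bilinear
Gaussian chaos of a matrix of larger norm, with probability bounded below. -/
theorem le_gam_linear_lt_bilinear {κ ι : Type} [Fintype κ] [Fintype ι] (a : κ → ℝ)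
    (M : κ × ι → ℝ) {ε : ℝ} (hε : 0 < ε) (h : ∑ i, a i ^ 2 < ε ^ 2 * ∑ p, M p ^ 2) :
    1 / 162 ≤ (gam (κ ⊕ ι)).real {w | |∑ i, a i * w (Sum.inl i)|
      < 2 * ε * |∑ p, M p * (w (Sum.inl p.1) * w (Sum.inr p.2))|} := by
  have hstd : ∀ _ : κ ⊕ ι, IsStd (gaussianReal 0 1) := fun _ => isStd_gaussianReal
  let e₁ : κ → Finset (κ ⊕ ι) := fun i => {Sum.inl i}
  let e₂ : κ × ι → Finset (κ ⊕ ι) := fun p => {Sum.inl p.1, Sum.inr p.2}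
  have he₁ : Function.Injective e₁ := fun i j hij => by simpa [e₁] using hij
  have he₂ : Function.Injective e₂ := fun p q hpq => by
    have h1 : Sum.inl p.1 ∈ e₂ q := hpq ▸ by simp [e₂]
    have h2 : Sum.inr p.2 ∈ e₂ q := hpq ▸ by simp [e₂]
    simp only [e₂, Finset.mem_insert, Finset.mem_singleton, Sum.inl.injEq, reduceCtorEq, or_false,
      Sum.inr.injEq, false_or] at h1 h2
    exact Prod.ext h1 h2
  have hcard : ∀ p, (e₂ p).card = 2 := fun p => Finset.card_pair (by simp)
  set f₁ := Function.extend e₁ a 0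
  set f₂ := Function.extend e₂ M 0
  have hL : ∀ w : κ ⊕ ι → ℝ, ∑ i, a i * w (Sum.inl i) = mev f₁ w := fun w => by
    rw [mev_extend e₁ he₁]; simp [e₁]
  have hB : ∀ w : κ ⊕ ι → ℝ, ∑ p, M p * (w (Sum.inl p.1) * w (Sum.inr p.2)) = mev f₂ w :=
    fun w => by
    rw [mev_extend e₂ he₂]
    exact Finset.sum_congr rfl fun p _ => by rw [Finset.prod_pair (by simp)]
  simp_rw [hL, hB]
  set A : Set (κ ⊕ ι → ℝ) := {w | |mev f₁ w| < 2 * ε * |mev f₂ w|}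
  have hA : MeasurableSet A := (isOpen_lt (isPoly_mev f₁).continuous.abs
    (continuous_const.mul (isPoly_mev f₂).continuous.abs)).measurableSet
  set m := ∑ p, M p ^ 2
  have hm : 0 < m := by
    by_contra hm
    have h0 : 0 ≤ ∑ i, a i ^ 2 := Finset.sum_nonneg fun i _ => sq_nonneg _
    nlinarith [sq_nonneg ε]
  have i1 : ∫ w, mev f₁ w ^ 2 ∂(gam (κ ⊕ ι)) = ∑ i, a i ^ 2 := by
    unfold gam
    rw [integral_mev_sq hstd f₁, sum_extend e₁ he₁ a (fun _ t => t ^ 2) (by simp)]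
  have i2 : ∫ w, mev f₂ w ^ 2 ∂(gam (κ ⊕ ι)) = m := by
    unfold gam
    rw [integral_mev_sq hstd f₂, sum_extend e₂ he₂ M (fun _ t => t ^ 2) (by simp)]
  have i4 : ∫ w, mev f₂ w ^ 4 ∂(gam (κ ⊕ ι)) ≤ 81 * m ^ 2 := by
    unfold gam
    refine (integral_mev_four_le hstd f₂).trans (le_of_eq ?_)
    rw [sum_extend e₂ he₂ M (fun S t => 3 ^ S.card * t ^ 2) (by simp)]
    simp only [hcard]
    rw [← Finset.mul_sum]; ring
  have int1 : Integrable (fun w => mev f₁ w ^ 2) (gam (κ ⊕ ι)) :=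
    ((isPoly_mev f₁).pow 2).integrable hstd
  have int2 : Integrable (fun w => mev f₂ w ^ 2) (gam (κ ⊕ ι)) :=
    ((isPoly_mev f₂).pow 2).integrable hstd
  have int4 : Integrable (fun w => mev f₂ w ^ 4) (gam (κ ⊕ ι)) :=
    ((isPoly_mev f₂).pow 4).integrable hstd
  have intA : Integrable (A.indicator fun _ => (1 : ℝ)) (gam (κ ⊕ ι)) :=
    (integrable_const 1).indicator hA
  have key : ∀ w, mev f₂ w ^ 2 ≤ (4 * ε ^ 2)⁻¹ * mev f₁ w ^ 2 + ((324 * m)⁻¹ * mev f₂ w ^ 4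
      + 81 * m * A.indicator (fun _ => (1 : ℝ)) w) := by
    intro w
    have h4 : 0 ≤ (324 * m)⁻¹ * mev f₂ w ^ 4 := by positivity
    by_cases hw : w ∈ A
    · rw [Set.indicator_of_mem hw]
      have h1 : 0 ≤ (4 * ε ^ 2)⁻¹ * mev f₁ w ^ 2 := by positivity
      have h2 : (324 * m)⁻¹ * mev f₂ w ^ 4 + 81 * m * 1 - mev f₂ w ^ 2
          = (324 * m)⁻¹ * (mev f₂ w ^ 2 - 162 * m) ^ 2 := by
        field_simp; ring
      have h3 : 0 ≤ (324 * m)⁻¹ * (mev f₂ w ^ 2 - 162 * m) ^ 2 := by positivity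
      linarith
    · rw [Set.indicator_of_notMem hw]
      have h1 : 2 * ε * |mev f₂ w| ≤ |mev f₁ w| := not_lt.1 hw
      have h2 := pow_le_pow_left₀ (by positivity) h1 2
      rw [mul_pow, sq_abs, sq_abs] at h2
      have h3 : mev f₂ w ^ 2 ≤ (4 * ε ^ 2)⁻¹ * mev f₁ w ^ 2 := by
        rw [inv_mul_eq_div, le_div_iff₀ (by positivity)]; linarith
      linarith
  have intS : Integrable (fun w => (324 * m)⁻¹ * mev f₂ w ^ 4
      + 81 * m * A.indicator (fun _ => (1 : ℝ)) w) (gam (κ ⊕ ι)) :=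
    (int4.const_mul _).add (intA.const_mul _)
  have hone : ∫ w, A.indicator (fun _ => (1 : ℝ)) w ∂(gam (κ ⊕ ι)) = (gam (κ ⊕ ι)).real A :=
    integral_indicator_one hA
  have hint := integral_mono int2 ((int1.const_mul _).add intS) key
  simp only [Pi.add_apply] at hint
  rw [integral_add (int1.const_mul _) intS,
    integral_add (int4.const_mul _) (intA.const_mul _), integral_const_mul, integral_const_mul,
    integral_const_mul, hone, i1, i2] at hint
  have h1 : (4 * ε ^ 2)⁻¹ * ∑ i, a i ^ 2 ≤ m / 4 := by
    rw [inv_mul_eq_div, div_le_iff₀ (by positivity)]; linarith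
  have h2 : (324 * m)⁻¹ * ∫ w, mev f₂ w ^ 4 ∂(gam (κ ⊕ ι)) ≤ m / 4 := by
    rw [inv_mul_eq_div, div_le_iff₀ (by positivity)]; nlinarith
  by_contra hcon
  push Not at hcon
  nlinarith

/-- A vector of polynomials is rarely small compared to its Jacobian. -/
theorem gam_vector_small {κ ι : Type} [Fintype κ] [Fintype ι] (d : ℕ)
    (v : κ → Finset ι → ℝ) (hv : ∀ i S, d < S.card → v i S = 0) {ε : ℝ} (hε : 0 < ε) :
    gam ι {x | ∑ i, mev (v i) x ^ 2 < ε ^ 2 * ∑ p : κ × ι, mev (mder p.2 (v p.1)) x ^ 2}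
      ≤ ENNReal.ofReal (20736 * (d + 1) ^ 2 * ε) := by
  let P : (κ → ℝ) → Finset ι → ℝ := fun Z S => ∑ i, Z i * v i S
  have hc : ∀ g : Finset ι → ℝ, Continuous (mev g) := fun g => (isPoly_mev g).continuous
  have hP : ∀ Z x, mev (P Z) x = ∑ i, mev (v i) x * Z i := by
    intro Z x
    unfold mev
    simp_rw [P, Finset.sum_mul]
    rw [Finset.sum_comm]
    exact Finset.sum_congr rfl fun i _ => Finset.sum_congr rfl fun S _ => by ring
  have hPd : ∀ (Z : κ → ℝ) (Y x : ι → ℝ), ∑ l, Y l * mev (mder l (P Z)) x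
      = ∑ p : κ × ι, mev (mder p.2 (v p.1)) x * (Z p.1 * Y p.2) := by
    intro Z Y x
    have : ∀ l, mev (mder l (P Z)) x = ∑ i, Z i * mev (mder l (v i)) x := by
      intro l
      unfold mev
      simp_rw [Finset.mul_sum]
      rw [Finset.sum_comm]
      refine Finset.sum_congr rfl fun S _ => ?_
      unfold mder
      split_ifs
      · simp
      · simp_rw [P, Finset.sum_mul]
        exact Finset.sum_congr rfl fun i _ => by ring
    simp_rw [this, Finset.mul_sum]
    rw [Finset.sum_comm, Fintype.sum_prod_type]
    exact Finset.sum_congr rfl fun i _ => Finset.sum_congr rfl fun l _ => by ring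
  let W : Set ((κ → ℝ) × (ι → ℝ) × (ι → ℝ)) := {z | |∑ i, mev (v i) z.2.1 * z.1 i|
    < 2 * ε * |∑ p : κ × ι, mev (mder p.2 (v p.1)) z.2.1 * (z.1 p.1 * z.2.2 p.2)|}
  have hW : MeasurableSet W := by
    refine (isOpen_lt ?_ ?_).measurableSet
    · refine (continuous_finsetSum _ fun i _ => ?_).abs
      exact ((hc _).comp (by fun_prop)).mul (by fun_prop)
    · refine continuous_const.mul (continuous_finsetSum _ fun i _ => ?_).abs
      exact ((hc _).comp (by fun_prop)).mul (by fun_prop)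
  have hup : ∀ Z, ((gam ι).prod (gam ι)) {q | (Z, q) ∈ W}
      ≤ ENNReal.ofReal (128 * (d + 1) ^ 2 * ε) := by
    intro Z
    have := gam_prod_small d (P Z) (fun S hS => by simp [P, hv _ S hS])
      (by positivity : 0 < 2 * ε)
    simp_rw [hP, hPd] at this
    refine this.trans (ENNReal.ofReal_le_ofReal (by linarith))
  have hWm : Measurable fun q : (κ → ℝ) × (ι → ℝ) => gam ι {Y | (q.1, q.2, Y) ∈ W} := by
    have h := measurable_measure_prodMk_left (ν := gam ι)
      (hW.preimage (by fun_prop : Measurable fun t : ((κ → ℝ) × (ι → ℝ)) × (ι → ℝ) =>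
        (t.1.1, t.1.2, t.2)))
    exact h
  have hswap : ∫⁻ x, ((gam κ).prod (gam ι)) {q | (q.1, x, q.2) ∈ W} ∂(gam ι)
      ≤ ENNReal.ofReal (128 * (d + 1) ^ 2 * ε) := by
    have e1 : ∀ x, ((gam κ).prod (gam ι)) {q | (q.1, x, q.2) ∈ W}
        = ∫⁻ Z, gam ι {Y | (Z, x, Y) ∈ W} ∂(gam κ) := fun x =>
      Measure.prod_apply (hW.preimage (by fun_prop : Measurable fun q : (κ → ℝ) × (ι → ℝ) =>
        (q.1, x, q.2)))
    have e2 : ∀ Z, ((gam ι).prod (gam ι)) {q | (Z, q) ∈ W}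
        = ∫⁻ x, gam ι {Y | (Z, x, Y) ∈ W} ∂(gam ι) := fun Z =>
      Measure.prod_apply (hW.preimage (by fun_prop : Measurable fun q : (ι → ℝ) × (ι → ℝ) =>
        (Z, q)))
    simp_rw [e1]
    rw [lintegral_lintegral_swap (f := fun x Z => gam ι {Y | (Z, x, Y) ∈ W})
      (hWm.comp measurable_swap).aemeasurable]
    simp_rw [← e2]
    exact (lintegral_mono hup).trans (by simp)
  set A := {x | ∑ i, mev (v i) x ^ 2 < ε ^ 2 * ∑ p : κ × ι, mev (mder p.2 (v p.1)) x ^ 2}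
  have hlow : ∀ x ∈ A, ENNReal.ofReal (1 / 162)
      ≤ ((gam κ).prod (gam ι)) {q | (q.1, x, q.2) ∈ W} := by
    intro x hx
    have h := le_gam_linear_lt_bilinear (fun i => mev (v i) x)
      (fun p => mev (mder p.2 (v p.1)) x) hε hx
    rw [← ENNReal.ofReal_le_ofReal_iff measureReal_nonneg, ofReal_measureReal] at h
    have hmp := measurePreserving_sumPiEquivProdPi (X := fun _ : κ ⊕ ι => ℝ)
      fun _ => gaussianReal 0 1
    refine h.trans (le_of_eq ?_)
    exact hmp.measure_preimage (hW.preimage (by fun_prop :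
      Measurable fun q : (κ → ℝ) × (ι → ℝ) => (q.1, x, q.2))).nullMeasurableSet
  have hA : MeasurableSet A := by
    refine (isOpen_lt ?_ ?_).measurableSet
    · exact continuous_finsetSum _ fun i _ => (hc _).pow 2
    · exact continuous_const.mul (continuous_finsetSum _ fun i _ => (hc _).pow 2)
  have hfin : ENNReal.ofReal (1 / 162) * gam ι A ≤ ENNReal.ofReal (128 * (d + 1) ^ 2 * ε) := by
    refine le_trans ?_ hswap
    rw [← setLIntegral_const]
    exact (setLIntegral_mono' hA hlow).trans (setLIntegral_le_lintegral _ _)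
  calc gam ι A = ENNReal.ofReal 162 * (ENNReal.ofReal (1 / 162) * gam ι A) := by
        rw [← mul_assoc, ← ENNReal.ofReal_mul (by norm_num)]; norm_num
    _ ≤ ENNReal.ofReal 162 * ENNReal.ofReal (128 * (d + 1) ^ 2 * ε) := by gcongr
    _ = ENNReal.ofReal (20736 * (d + 1) ^ 2 * ε) := by
        rw [← ENNReal.ofReal_mul (by norm_num)]; ring_nf

theorem mev_eq_const {ι : Type} [Fintype ι] (f : Finset ι → ℝ) (hf : ∀ S, S ≠ ∅ → f S = 0)
    (x : ι → ℝ) : mev f x = f ∅ := by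
  unfold mev
  rw [Finset.sum_eq_single ∅ (fun S _ hS => by rw [hf S hS, zero_mul]) (by simp)]
  simp

/-- A vector of polynomials with small variance is rarely near the origin. -/
theorem gam_small_of_small_variance {κ ι : Type} [Fintype κ] [Fintype ι]
    (v : κ → Finset ι → ℝ) {s ε : ℝ} (hs : 0 < s) (hε : 0 < ε)
    (hsum : s ≤ ∑ i, ∑ S, v i S ^ 2)
    (hvar : ∑ i, ∑ S, (if S = ∅ then 0 else v i S ^ 2) ≤ ε * s) :
    gam ι {x | ∑ i, mev (v i) x ^ 2 ≤ s * ε / 4} ≤ ENNReal.ofReal (4 * ε) := by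
  by_cases h4 : 1 / 4 < ε
  · refine prob_le_one.trans ?_
    rw [← ENNReal.ofReal_one]
    exact ENNReal.ofReal_le_ofReal (by linarith)
  push Not at h4
  let w : κ → Finset ι → ℝ := fun i S => if S = ∅ then 0 else v i S
  have hw : ∀ i S, w i S ^ 2 = if S = ∅ then 0 else v i S ^ 2 := fun i S => by
    simp only [w]; split_ifs <;> simp
  have hsplit : ∀ i x, mev (v i) x = v i ∅ + mev (w i) x := by
    intro i x
    have : mev (w i) x = mev (v i) x - mev (fun S => if S = ∅ then v i S else 0) x := by
      unfold mev
      rw [← Finset.sum_sub_distrib]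
      refine Finset.sum_congr rfl fun S _ => ?_
      simp only [w]; split_ifs <;> ring
    rw [this, mev_eq_const (fun S => if S = ∅ then v i S else 0) fun S hS => if_neg hS]
    simp
  have hsq : ∑ i, ∑ S, v i S ^ 2 = ∑ i, v i ∅ ^ 2 + ∑ i, ∑ S, w i S ^ 2 := by
    rw [← Finset.sum_add_distrib]
    refine Finset.sum_congr rfl fun i _ => ?_
    have : v i ∅ ^ 2 = ∑ S, if S = ∅ then v i S ^ 2 else 0 := by simp
    rw [this, ← Finset.sum_add_distrib]
    exact Finset.sum_congr rfl fun S _ => by rw [hw]; split_ifs <;> ring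
  have hvar' : ∑ i, ∑ S, w i S ^ 2 ≤ ε * s := by simpa only [hw] using hvar
  have hstd : ∀ _ : ι, IsStd (gaussianReal 0 1) := fun _ => isStd_gaussianReal
  have hi : ∀ i, Integrable (fun x => mev (w i) x ^ 2) (gam ι) := fun i =>
    ((isPoly_mev (w i)).pow 2).integrable hstd
  have hE : ∫ x, ∑ i, mev (w i) x ^ 2 ∂(gam ι) = ∑ i, ∑ S, w i S ^ 2 := by
    rw [integral_finsetSum _ fun i _ => hi i]
    exact Finset.sum_congr rfl fun i _ => integral_mev_sq hstd (w i)
  have hmk := mul_meas_ge_le_integral_of_nonneg (μ := gam ι)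
    (f := fun x => ∑ i, mev (w i) x ^ 2)
    (Filter.Eventually.of_forall fun x => Finset.sum_nonneg fun i _ => sq_nonneg _)
    (integrable_finsetSum _ fun i _ => hi i) (s / 4)
  rw [hE] at hmk
  have hsub : {x | ∑ i, mev (v i) x ^ 2 ≤ s * ε / 4}
      ⊆ {x | s / 4 ≤ ∑ i, mev (w i) x ^ 2} := by
    intro x hx
    have hx' : ∑ i, mev (v i) x ^ 2 ≤ s * ε / 4 := hx
    have h1 : ∑ i, v i ∅ ^ 2 ≤ 2 * ∑ i, mev (w i) x ^ 2 + 2 * ∑ i, mev (v i) x ^ 2 := by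
      rw [Finset.mul_sum, Finset.mul_sum, ← Finset.sum_add_distrib]
      refine Finset.sum_le_sum fun i _ => ?_
      rw [hsplit]
      nlinarith [sq_nonneg (v i ∅ + 2 * mev (w i) x)]
    change s / 4 ≤ _
    nlinarith
  refine (measure_mono hsub).trans ?_
  rw [← ofReal_measureReal]
  refine ENNReal.ofReal_le_ofReal ?_
  by_contra hcon
  push Not at hcon
  nlinarith

/-- Small-ball estimate for a vector of polynomials of degree at most `d`. -/
theorem gam_small_ball {ι : Type} [Fintype ι] (d : ℕ) : ∀ (κ : Type) [Fintype κ]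
    (v : κ → Finset ι → ℝ), (∀ i S, d < S.card → v i S = 0) → ∀ s ε : ℝ, 0 < s → 0 < ε →
    ε ≤ 1 → s ≤ ∑ i, ∑ S, v i S ^ 2 →
    gam ι {x | ∑ i, mev (v i) x ^ 2 ≤ s * ε ^ (3 * d) / 4}
      ≤ ENNReal.ofReal (20736 * (d + 1) ^ 3 * ε) := by
  induction d with
  | zero =>
    intro κ _ v hv s ε hs hε _ hsum
    have h0 : ∀ i S, S ≠ ∅ → v i S = 0 := fun i S hS =>
      hv i S (Finset.card_pos.2 (Finset.nonempty_iff_ne_empty.2 hS))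
    have h1 : ∀ i, ∑ S, v i S ^ 2 = v i ∅ ^ 2 := fun i =>
      Finset.sum_eq_single ∅ (fun S _ hS => by rw [h0 i S hS]; simp) (by simp)
    simp_rw [h1] at hsum
    have : {x | ∑ i, mev (v i) x ^ 2 ≤ s * ε ^ (3 * 0) / 4} = ∅ := by
      refine Set.eq_empty_of_forall_notMem fun x hx => ?_
      have hx' : ∑ i, mev (v i) x ^ 2 ≤ s * ε ^ (3 * 0) / 4 := hx
      simp_rw [fun i => mev_eq_const (v i) (h0 i) x] at hx'
      simp only [mul_zero, pow_zero, mul_one] at hx'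
      linarith
    rw [this]; simp
  | succ d ih =>
    intro κ _ v hv s ε hs hε hε1 hsum
    rcases le_or_gt (∑ i, ∑ S, (if S = ∅ then 0 else v i S ^ 2)) (ε * s) with hvar | hvar
    · have hpow : ε ^ (3 * (d + 1)) ≤ ε := by
        calc ε ^ (3 * (d + 1)) ≤ ε ^ 1 := pow_le_pow_of_le_one hε.le hε1 (by omega)
          _ = ε := pow_one ε
      refine (measure_mono fun x hx => ?_).trans
        ((gam_small_of_small_variance v hs hε hsum hvar).trans (ENNReal.ofReal_le_ofReal ?_))
      · have hx' : ∑ i, mev (v i) x ^ 2 ≤ s * ε ^ (3 * (d + 1)) / 4 := hx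
        exact hx'.trans (by gcongr)
      · have : (1 : ℝ) ≤ ((d + 1 : ℕ) + 1 : ℝ) ^ 3 := one_le_pow₀ (by linarith [Nat.cast_nonneg (α := ℝ) (d + 1)])
        nlinarith
    · have hgrad : ε * s ≤ ∑ p : κ × ι, ∑ S, mder p.2 (v p.1) S ^ 2 := by
        refine hvar.le.trans ?_
        rw [Fintype.sum_prod_type]
        refine Finset.sum_le_sum fun i _ => ?_
        refine le_of_le_of_eq ?_ (sum_sum_mder_sq (v i)).symm
        refine Finset.sum_le_sum fun S _ => ?_
        split_ifs with h
        · positivity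
        · have : (1 : ℝ) ≤ S.card := by
            exact_mod_cast Finset.card_pos.2 (Finset.nonempty_iff_ne_empty.2 h)
          nlinarith [sq_nonneg (v i S)]
      have h1 := ih (κ × ι) (fun p => mder p.2 (v p.1)) (fun p S hS => by
        unfold mder
        split_ifs with h
        · rfl
        · exact hv _ _ (by rw [Finset.card_insert_of_notMem h]; omega))
        (ε * s) ε (by positivity) hε hε1 hgrad
      have h2 := gam_vector_small (d + 1) v hv hε
      have hsub : {x | ∑ i, mev (v i) x ^ 2 ≤ s * ε ^ (3 * (d + 1)) / 4}
          ⊆ {x | ∑ p : κ × ι, mev (mder p.2 (v p.1)) x ^ 2 ≤ ε * s * ε ^ (3 * d) / 4}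
            ∪ {x | ∑ i, mev (v i) x ^ 2
                < ε ^ 2 * ∑ p : κ × ι, mev (mder p.2 (v p.1)) x ^ 2} := by
        intro x hx
        have hx' : ∑ i, mev (v i) x ^ 2 ≤ s * ε ^ (3 * (d + 1)) / 4 := hx
        rcases le_or_gt (∑ p : κ × ι, mev (mder p.2 (v p.1)) x ^ 2)
          (ε * s * ε ^ (3 * d) / 4) with h | h
        · exact Or.inl h
        · refine Or.inr (hx'.trans_lt ?_)
          calc s * ε ^ (3 * (d + 1)) / 4 = ε ^ 2 * (ε * s * ε ^ (3 * d) / 4) := by ring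
            _ < _ := by gcongr
      refine (measure_mono hsub).trans ((measure_union_le _ _).trans ((add_le_add h1 h2).trans ?_))
      rw [← ENNReal.ofReal_add (by positivity) (by positivity)]
      refine ENNReal.ofReal_le_ofReal ?_
      push_cast
      have hd : (0 : ℝ) ≤ d := Nat.cast_nonneg d
      have : (d + 1 : ℝ) ^ 3 + (d + 1 + 1) ^ 2 ≤ (d + 1 + 1) ^ 3 := by nlinarith [sq_nonneg (d : ℝ)]
      nlinarith

theorem exists_bound_iteratedDeriv_smoothTransition (j : ℕ) :
    ∃ C : ℝ, 0 ≤ C ∧ ∀ x, |iteratedDeriv j Real.smoothTransition x| ≤ C := by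
  have hc : Continuous (iteratedDeriv j Real.smoothTransition) :=
    (Real.smoothTransition.contDiff (n := ⊤)).continuous_iteratedDeriv j (by exact_mod_cast le_top)
  obtain ⟨C, hC⟩ := (isCompact_Icc (a := (0 : ℝ)) (b := 1)).exists_bound_of_continuousOn
    hc.continuousOn
  refine ⟨max C 1, by positivity, fun x => ?_⟩
  rcases lt_or_ge x 0 with h0 | h0
  · have h : Real.smoothTransition =ᶠ[nhds x] fun _ => 0 := by
      filter_upwards [Iio_mem_nhds h0] with y hy
      exact Real.smoothTransition.zero_of_nonpos (le_of_lt hy)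
    rw [h.iteratedDeriv_eq, iteratedDeriv_const]
    simp
  rcases le_or_gt x 1 with h1 | h1
  · exact (hC x ⟨h0, h1⟩).trans (le_max_left _ _)
  · have h : Real.smoothTransition =ᶠ[nhds x] fun _ => 1 := by
      filter_upwards [Ioi_mem_nhds h1] with y hy
      exact Real.smoothTransition.one_of_one_le (le_of_lt hy)
    rw [h.iteratedDeriv_eq, iteratedDeriv_const]
    split_ifs <;> simp

theorem exists_bound_smoothTransition : ∃ K : ℝ, 1 ≤ K ∧ ∀ j ≤ 4, ∀ x,
    |iteratedDeriv j Real.smoothTransition x| ≤ K ^ j := by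
  choose C hC0 hC using exists_bound_iteratedDeriv_smoothTransition
  refine ⟨1 + ∑ j ∈ Finset.range 5, C j,
    by linarith [Finset.sum_nonneg fun j (_ : j ∈ Finset.range 5) => hC0 j], fun j hj x => ?_⟩
  set K := 1 + ∑ j ∈ Finset.range 5, C j with hK
  have hK1 : 1 ≤ K := by linarith [Finset.sum_nonneg fun j (_ : j ∈ Finset.range 5) => hC0 j]
  rcases Nat.eq_zero_or_pos j with rfl | h
  · rw [iteratedDeriv_zero, pow_zero, abs_of_nonneg (Real.smoothTransition.nonneg x)]
    exact Real.smoothTransition.le_one x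
  · have h1 : C j ≤ ∑ j ∈ Finset.range 5, C j :=
      Finset.single_le_sum (fun j _ => hC0 j) (Finset.mem_range.2 (by omega))
    have h2 : K ≤ K ^ j := le_self_pow₀ hK1 h.ne'
    linarith [hC j x]

theorem contDiff_prod_smoothTransition {κ : Type} (s : Finset κ) (A B : κ → ℝ) (n : ℕ) :
    ContDiff ℝ n fun t => ∏ i ∈ s, Real.smoothTransition (A i + B i * t) :=
  contDiff_prod fun i _ => (Real.smoothTransition.contDiff (n := n)).comp (by fun_prop)

theorem abs_iteratedDeriv_prod_le {κ : Type} {K : ℝ} (hK : 1 ≤ K)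
    (hφ : ∀ j ≤ 4, ∀ x, |iteratedDeriv j Real.smoothTransition x| ≤ K ^ j)
    (A B : κ → ℝ) (s : Finset κ) : ∀ j ≤ 4, ∀ t,
      |iteratedDeriv j (fun t => ∏ i ∈ s, Real.smoothTransition (A i + B i * t)) t|
        ≤ (K * ∑ i ∈ s, |B i|) ^ j := by
  induction s using Finset.induction_on with
  | empty =>
    intro j _ t
    simp only [Finset.prod_empty, iteratedDeriv_const, Finset.sum_empty, mul_zero]
    rcases Nat.eq_zero_or_pos j with rfl | h
    · simp
    · simp [h.ne']
  | insert a s ha ih =>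
    intro j hj t
    have h1 : ∀ m : ℕ, ContDiff ℝ m fun t => Real.smoothTransition (A a + B a * t) := fun m =>
      (Real.smoothTransition.contDiff (n := m)).comp (by fun_prop)
    have h2 : ∀ m ≤ 4, |iteratedDeriv m (fun t => Real.smoothTransition (A a + B a * t)) t|
        ≤ (K * |B a|) ^ m := by
      intro m hm
      have hs : ContDiff ℝ m fun z => Real.smoothTransition (A a + z) :=
        (Real.smoothTransition.contDiff (n := m)).comp (by fun_prop)
      have e := iteratedDeriv_comp_const_mul hs (B a)
      rw [iteratedDeriv_comp_const_add] at e
      rw [congrFun e t, abs_mul, abs_pow, mul_pow, mul_comm (K ^ m)]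
      gcongr
      exact hφ m hm _
    simp_rw [Finset.prod_insert ha]
    rw [iteratedDeriv_fun_mul (h1 j).contDiffAt
      (contDiff_prod_smoothTransition s A B j).contDiffAt, Finset.sum_insert ha, mul_add, add_pow]
    refine (Finset.abs_sum_le_sum_abs _ _).trans (Finset.sum_le_sum fun m hm => ?_)
    have hm' : m ≤ j := Nat.lt_succ_iff.1 (Finset.mem_range.1 hm)
    rw [abs_mul, abs_mul, Nat.abs_cast]
    calc _ ≤ (j.choose m : ℝ) * (K * |B a|) ^ m * (K * ∑ i ∈ s, |B i|) ^ (j - m) := by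
          gcongr
          · exact h2 m (hm'.trans hj)
          · exact ih (j - m) (by omega) t
      _ = _ := by ring

theorem exists_taylor_cubic {h : ℝ → ℝ} (hh : ContDiff ℝ 4 h) {M : ℝ}
    (hM : ∀ t, |iteratedDeriv 4 h t| ≤ M) : ∃ a b c : ℝ, ∀ t,
      |h t - (h 0 + a * t + b * t ^ 2 + c * t ^ 3)| ≤ M / 24 * t ^ 4 := by
  refine ⟨iteratedDeriv 1 h 0, iteratedDeriv 2 h 0 / 2, iteratedDeriv 3 h 0 / 6, fun t => ?_⟩
  by_cases ht : t = 0
  · subst ht; simp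
  have ht' : (0 : ℝ) ≠ t := Ne.symm ht
  obtain ⟨x, -, hx⟩ := taylor_mean_remainder_lagrange_iteratedDeriv (n := 3) ht'
    (f := h) (by exact_mod_cast hh.contDiffOn)
  have hd : ∀ j ≤ 4, iteratedDerivWithin j h (Set.uIcc 0 t) 0 = iteratedDeriv j h 0 := fun j hj =>
    iteratedDerivWithin_eq_iteratedDeriv (uniqueDiffOn_uIcc ht')
      (hh.contDiffAt.of_le (by exact_mod_cast hj)) Set.left_mem_uIcc
  rw [taylor_within_apply] at hx
  simp only [Finset.sum_range_succ, Finset.sum_range_zero, hd 0 (by norm_num), hd 1 (by norm_num),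
    hd 2 (by norm_num), hd 3 (by norm_num), sub_zero, smul_eq_mul, iteratedDeriv_zero] at hx
  have e : h t - (h 0 + iteratedDeriv 1 h 0 * t + iteratedDeriv 2 h 0 / 2 * t ^ 2
      + iteratedDeriv 3 h 0 / 6 * t ^ 3) = iteratedDeriv 4 h x * t ^ 4 / 24 := by
    norm_num [Nat.factorial] at hx
    rw [iteratedDeriv_one]
    linarith
  rw [e, abs_div, abs_mul, abs_of_nonneg (by positivity : (0 : ℝ) ≤ t ^ 4)]
  have h0 := hM x
  have : |iteratedDeriv 4 h x| * t ^ 4 ≤ M * t ^ 4 := by gcongr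
  norm_num
  linarith

theorem abs_integral_sub_cubic_le {ν : Measure ℝ} (hν : IsStd ν) {h : ℝ → ℝ}
    (hi : Integrable h ν) {M a b c : ℝ} (hM0 : 0 ≤ M)
    (hM : ∀ t, |h t - (h 0 + a * t + b * t ^ 2 + c * t ^ 3)| ≤ M / 24 * t ^ 4) :
    |∫ t, h t ∂ν - (h 0 + b)| ≤ M / 8 := by
  have := hν.prob
  have i1 : Integrable (fun t : ℝ => t) ν := by simpa using hν.integrable_pow 1
  have i2 := hν.integrable_pow 2
  have i3 := hν.integrable_pow 3
  have i4 := hν.integrable_pow 4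
  have ia : Integrable (fun t => h 0 + a * t) ν := (integrable_const _).add (i1.const_mul a)
  have ib : Integrable (fun t => h 0 + a * t + b * t ^ 2) ν := ia.add (i2.const_mul b)
  have ic : Integrable (fun t => h 0 + a * t + b * t ^ 2 + c * t ^ 3) ν := ib.add (i3.const_mul c)
  have e : ∫ t, h 0 + a * t + b * t ^ 2 + c * t ^ 3 ∂ν = h 0 + b := by
    rw [integral_add ib (i3.const_mul c), integral_add ia (i2.const_mul b),
      integral_add (integrable_const _) (i1.const_mul a), integral_const_mul, integral_const_mul,
      integral_const_mul, hν.moment_one, hν.moment_two, hν.moment_three]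
    simp
  rw [← e, ← integral_sub hi ic]
  have h1 := norm_integral_le_of_norm_le (f := fun t => h t - (h 0 + a * t + b * t ^ 2 + c * t ^ 3))
    (i4.const_mul (M / 24)) (Filter.Eventually.of_forall hM)
  rw [integral_const_mul] at h1
  refine h1.trans ?_
  have := hν.moment_four
  nlinarith

/-- Replacing one standardised variable by another changes the expectation of a product of smooth
step functions of affine forms by little. -/
theorem abs_integral_sub_integral_prod_le {κ : Type} [Fintype κ] {K : ℝ} (hK : 1 ≤ K)
    (hφ : ∀ j ≤ 4, ∀ x, |iteratedDeriv j Real.smoothTransition x| ≤ K ^ j)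
    {ν₁ ν₂ : Measure ℝ} (h₁ : IsStd ν₁) (h₂ : IsStd ν₂) (A B : κ → ℝ) :
    |∫ t, ∏ i, Real.smoothTransition (A i + t * B i) ∂ν₁
        - ∫ t, ∏ i, Real.smoothTransition (A i + t * B i) ∂ν₂|
      ≤ K ^ 4 * Fintype.card κ ^ 3 / 4 * ∑ i, B i ^ 4 := by
  simp_rw [mul_comm _ (B _)]
  set h : ℝ → ℝ := fun t => ∏ i, Real.smoothTransition (A i + B i * t)
  have hs : ContDiff ℝ 4 h := by exact_mod_cast contDiff_prod_smoothTransition Finset.univ A B 4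
  have hi : ∀ {ν : Measure ℝ}, IsStd ν → Integrable h ν := fun {ν} hν => by
    have := hν.prob
    refine Integrable.of_bound hs.continuous.aestronglyMeasurable 1
      (Filter.Eventually.of_forall fun t => ?_)
    rw [Real.norm_eq_abs, abs_of_nonneg (Finset.prod_nonneg fun i _ => Real.smoothTransition.nonneg _)]
    exact Finset.prod_le_one (fun i _ => Real.smoothTransition.nonneg _)
      fun i _ => Real.smoothTransition.le_one _
  have hM := abs_iteratedDeriv_prod_le hK hφ A B Finset.univ 4 le_rfl
  obtain ⟨a, b, c, hT⟩ := exists_taylor_cubic hs hM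
  have hM0 : 0 ≤ (K * ∑ i, |B i|) ^ 4 := by positivity
  have e1 := abs_integral_sub_cubic_le h₁ (hi h₁) hM0 hT
  have e2 := abs_integral_sub_cubic_le h₂ (hi h₂) hM0 hT
  have hpow : (∑ i, |B i|) ^ 4 ≤ Fintype.card κ ^ 3 * ∑ i, B i ^ 4 := by
    have h1 : (∑ i, |B i|) ^ 2 ≤ Fintype.card κ * ∑ i, B i ^ 2 := by
      simpa using sq_sum_le_card_mul_sum_sq (s := Finset.univ) (f := fun i => |B i|)
    have h2 : (∑ i, B i ^ 2) ^ 2 ≤ Fintype.card κ * ∑ i, B i ^ 4 := by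
      have := sq_sum_le_card_mul_sum_sq (s := Finset.univ) (f := fun i => B i ^ 2)
      simpa [← pow_mul] using this
    calc (∑ i, |B i|) ^ 4 = ((∑ i, |B i|) ^ 2) ^ 2 := by ring
      _ ≤ (Fintype.card κ * ∑ i, B i ^ 2) ^ 2 := by gcongr
      _ = (Fintype.card κ : ℝ) ^ 2 * (∑ i, B i ^ 2) ^ 2 := by ring
      _ ≤ (Fintype.card κ : ℝ) ^ 2 * (Fintype.card κ * ∑ i, B i ^ 4) := by gcongr
      _ = _ := by ring
  have hfin : (K * ∑ i, |B i|) ^ 4 ≤ K ^ 4 * (Fintype.card κ ^ 3 * ∑ i, B i ^ 4) := by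
    rw [mul_pow]; gcongr
  rw [abs_le] at e1 e2 ⊢
  constructor <;> linarith [e1.1, e1.2, e2.1, e2.2]

theorem integral_mev_four_le_of_degree {ι : Type} [Fintype ι] {μ : ι → Measure ℝ}
    (hμ : ∀ i, IsStd (μ i)) {d : ℕ} {f : Finset ι → ℝ} (hf : ∀ S, d < S.card → f S = 0) :
    ∫ x, mev f x ^ 4 ∂(Measure.pi μ) ≤ 9 ^ d * (∑ S, f S ^ 2) ^ 2 := by
  refine (integral_mev_four_le hμ f).trans ?_
  have h : ∑ S, 3 ^ S.card * f S ^ 2 ≤ 3 ^ d * ∑ S, f S ^ 2 := by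
    rw [Finset.mul_sum]
    refine Finset.sum_le_sum fun S _ => ?_
    by_cases hS : d < S.card
    · simp [hf S hS]
    · gcongr
      · norm_num
      · exact not_lt.1 hS
  have h0 : 0 ≤ ∑ S, (3 : ℝ) ^ S.card * f S ^ 2 := Finset.sum_nonneg fun S _ => by positivity
  calc _ ≤ (3 ^ d * ∑ S, f S ^ 2) ^ 2 := by gcongr
    _ = (3 ^ d) ^ 2 * (∑ S, f S ^ 2) ^ 2 := mul_pow _ _ _
    _ = _ := by rw [← pow_mul, mul_comm d 2, pow_mul]; norm_num

theorem mder_eq_zero_of_degree {ι : Type} [DecidableEq ι] {d : ℕ} {f : Finset ι → ℝ}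
    (hf : ∀ S, d < S.card → f S = 0) (l : ι) (S : Finset ι) (hS : d < S.card) :
    mder l f S = 0 := by
  unfold mder
  split_ifs with h
  · rfl
  · exact hf _ (by rw [Finset.card_insert_of_notMem h]; omega)

/-- Invariance principle for products of smooth steps of low-degree polynomials. -/
theorem abs_integral_rad_sub_gam_le {κ ι : Type} [Fintype κ] [Fintype ι] {K : ℝ} (hK : 1 ≤ K)
    (hφ : ∀ j ≤ 4, ∀ x, |iteratedDeriv j Real.smoothTransition x| ≤ K ^ j) (d : ℕ)
    (F : κ → Finset ι → ℝ) (hF : ∀ i S, d < S.card → F i S = 0) :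
    |∫ x, ∏ i, Real.smoothTransition (mev (F i) x) ∂(gam ι)
        - ∫ x, ∏ i, Real.smoothTransition (mev (F i) x) ∂(Measure.pi fun _ : ι => rad)|
      ≤ K ^ 4 * Fintype.card κ ^ 3 / 4 * 9 ^ d * ∑ l, ∑ i, (∑ S, mder l (F i) S ^ 2) ^ 2 := by
  set Φ : (ι → ℝ) → ℝ := fun x => ∏ i, Real.smoothTransition (mev (F i) x) with hΦ
  have hΦc : Continuous Φ := continuous_finsetProd _ fun i _ =>
    Real.smoothTransition.continuous.comp (isPoly_mev (F i)).continuous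
  have hΦi : ∀ μ : ι → Measure ℝ, (∀ i, IsStd (μ i)) → Integrable Φ (Measure.pi μ) := by
    intro μ hμ
    have := fun i => (hμ i).prob
    refine Integrable.of_bound hΦc.aestronglyMeasurable 1 (Filter.Eventually.of_forall fun t => ?_)
    rw [Real.norm_eq_abs,
      abs_of_nonneg (Finset.prod_nonneg fun i _ => Real.smoothTransition.nonneg _)]
    exact Finset.prod_le_one (fun i _ => Real.smoothTransition.nonneg _)
      fun i _ => Real.smoothTransition.le_one _
  have step : ∀ (μ : ι → Measure ℝ), (∀ i, IsStd (μ i)) → ∀ l,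
      |∫ x, Φ x ∂(Measure.pi (Function.update μ l (gaussianReal 0 1)))
        - ∫ x, Φ x ∂(Measure.pi (Function.update μ l rad))|
      ≤ K ^ 4 * Fintype.card κ ^ 3 / 4 * 9 ^ d * ∑ i, (∑ S, mder l (F i) S ^ 2) ^ 2 := by
    intro μ hμ l
    have hprob := fun i => (hμ i).prob
    have hres : ∀ ν : Measure ℝ, IsStd ν →
        ∫ x, Φ x ∂(Measure.pi (Function.update μ l ν))
          = ∫ x, ∫ t, ∏ i, Real.smoothTransition
              (mev (mfree l (F i)) x + t * mev (mder l (F i)) x) ∂ν ∂(Measure.pi μ)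
        ∧ Integrable (fun x => ∫ t, ∏ i, Real.smoothTransition
              (mev (mfree l (F i)) x + t * mev (mder l (F i)) x) ∂ν) (Measure.pi μ) := by
      intro ν hν
      have := hν.prob
      have hup : ∀ i, IsStd (Function.update μ l ν i) := fun i => by
        by_cases h : i = l
        · subst h; simpa using hν
        · simpa [h] using hμ i
      have h1 := integral_resample μ hprob l ν (hΦi _ hup)
      have h2 := ((measurePreserving_update μ hprob l ν).integrable_comp_of_integrable
        (hΦi _ hup)).integral_prod_left
      simp only [hΦ, Function.comp_def, mev_update] at h1 h2 ⊢
      exact ⟨h1, h2⟩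
    obtain ⟨e1, i1⟩ := hres _ isStd_gaussianReal
    obtain ⟨e2, i2⟩ := hres _ isStd_rad
    rw [e1, e2, ← integral_sub i1 i2]
    have hi4 : ∀ i, Integrable (fun x => mev (mder l (F i)) x ^ 4) (Measure.pi μ) := fun i =>
      ((isPoly_mev _).pow 4).integrable hμ
    have hb := norm_integral_le_of_norm_le
      (f := fun x => (∫ t, ∏ i, Real.smoothTransition
          (mev (mfree l (F i)) x + t * mev (mder l (F i)) x) ∂(gaussianReal 0 1))
        - ∫ t, ∏ i, Real.smoothTransition
          (mev (mfree l (F i)) x + t * mev (mder l (F i)) x) ∂rad)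
      ((integrable_finsetSum Finset.univ fun i _ => hi4 i).const_mul
        (K ^ 4 * Fintype.card κ ^ 3 / 4))
      (Filter.Eventually.of_forall fun x => abs_integral_sub_integral_prod_le hK hφ
        isStd_gaussianReal isStd_rad (fun i => mev (mfree l (F i)) x)
        fun i => mev (mder l (F i)) x)
    refine hb.trans ?_
    rw [integral_const_mul, integral_finsetSum _ fun i _ => hi4 i, mul_assoc _ ((9 : ℝ) ^ d),
      Finset.mul_sum (a := (9 : ℝ) ^ d)]
    gcongr with i
    exact integral_mev_four_le_of_degree hμ (mder_eq_zero_of_degree (hF i) l)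
  let μ : Finset ι → ι → Measure ℝ := fun T i => if i ∈ T then gaussianReal 0 1 else rad
  have hμ : ∀ T i, IsStd (μ T i) := fun T i => by
    simp only [μ]; split_ifs
    exacts [isStd_gaussianReal, isStd_rad]
  have main : ∀ T : Finset ι,
      |∫ x, Φ x ∂(Measure.pi (μ T)) - ∫ x, Φ x ∂(Measure.pi fun _ : ι => rad)|
      ≤ ∑ l ∈ T, K ^ 4 * Fintype.card κ ^ 3 / 4 * 9 ^ d
        * ∑ i, (∑ S, mder l (F i) S ^ 2) ^ 2 := by
    intro T
    induction T using Finset.induction_on with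
    | empty => simp [μ]
    | insert l T hl ih =>
      have h1 : μ (insert l T) = Function.update (μ T) l (gaussianReal 0 1) := by
        funext i
        by_cases h : i = l
        · subst h; simp [μ]
        · simp [μ, h]
      have h2 : μ T = Function.update (μ T) l rad := by
        funext i
        by_cases h : i = l
        · subst h; simp [μ, hl]
        · simp [h]
      have h3 := step (μ T) (hμ T) l
      rw [← h1, ← h2] at h3
      rw [Finset.sum_insert hl]
      exact (abs_sub_le _ _ _).trans (add_le_add h3 ih)
  have h := main Finset.univ
  rw [← Finset.mul_sum] at h
  simpa [μ, gam] using h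

/-- The sign pattern of a family of polynomials at a point, with `true` for nonnegative. -/
noncomputable def pattern {κ ι : Type} [Fintype ι] (f : κ → Finset ι → ℝ) (x : ι → ℝ) :
    κ → Bool :=
  fun i => if 0 ≤ mev (f i) x then true else false

theorem measurableSet_pattern {κ ι : Type} [Fintype κ] [Fintype ι] (f : κ → Finset ι → ℝ)
    (g : (κ → Bool) → Bool) : MeasurableSet {x | g (pattern f x) = true} := by
  have hp : Measurable (pattern f) := measurable_pi_lambda _ fun i =>
    Measurable.ite (measurableSet_le measurable_const (isPoly_mev (f i)).continuous.measurable)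
      measurable_const measurable_const
  exact ((measurable_of_finite g).comp hp) (measurableSet_singleton true)

/-- The family `f`, with signs flipped so that the pattern `b` becomes all-positive, rescaled. -/
noncomputable def signScale {κ ι : Type} (b : κ → Bool) (r : ℝ) (f : κ → Finset ι → ℝ) :
    κ → Finset ι → ℝ :=
  fun i S => (if b i then r⁻¹ else -r⁻¹) * f i S

theorem mev_signScale {κ ι : Type} [Fintype ι] (b : κ → Bool) (r : ℝ) (f : κ → Finset ι → ℝ)
    (i : κ) (x : ι → ℝ) :
    mev (signScale b r f i) x = (if b i then r⁻¹ else -r⁻¹) * mev (f i) x := by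
  unfold mev signScale
  rw [Finset.mul_sum]
  exact Finset.sum_congr rfl fun S _ => mul_assoc _ _ _

theorem mder_signScale_sq {κ ι : Type} [DecidableEq ι] (b : κ → Bool) (r : ℝ)
    (f : κ → Finset ι → ℝ) (i : κ) (l : ι) (S : Finset ι) :
    mder l (signScale b r f i) S ^ 2 = (r ^ 2)⁻¹ * mder l (f i) S ^ 2 := by
  unfold mder signScale
  split_ifs <;> ring

/-- The smoothed indicator of the event that the pattern of `f` is `b`. -/
noncomputable def smoothInd {κ ι : Type} [Fintype κ] [Fintype ι] (r : ℝ)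
    (f : κ → Finset ι → ℝ) (b : κ → Bool) (x : ι → ℝ) : ℝ :=
  ∏ i, Real.smoothTransition (mev (signScale b r f i) x)

theorem smoothInd_nonneg {κ ι : Type} [Fintype κ] [Fintype ι] (r : ℝ)
    (f : κ → Finset ι → ℝ) (b : κ → Bool) (x : ι → ℝ) : 0 ≤ smoothInd r f b x :=
  Finset.prod_nonneg fun _ _ => Real.smoothTransition.nonneg _

theorem smoothInd_le_one {κ ι : Type} [Fintype κ] [Fintype ι] (r : ℝ)
    (f : κ → Finset ι → ℝ) (b : κ → Bool) (x : ι → ℝ) : smoothInd r f b x ≤ 1 :=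
  Finset.prod_le_one (fun _ _ => Real.smoothTransition.nonneg _)
    fun _ _ => Real.smoothTransition.le_one _

theorem smoothInd_eq_zero {κ ι : Type} [Fintype κ] [Fintype ι] {r : ℝ} (hr : 0 < r)
    (f : κ → Finset ι → ℝ) (b : κ → Bool) (x : ι → ℝ) (h : b ≠ pattern f x) :
    smoothInd r f b x = 0 := by
  obtain ⟨i, hi⟩ := Function.ne_iff.1 h
  refine Finset.prod_eq_zero (Finset.mem_univ i) (Real.smoothTransition.zero_of_nonpos ?_)
  have hr' : 0 < r⁻¹ := inv_pos.2 hr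
  rw [mev_signScale]
  unfold pattern at hi
  by_cases h1 : 0 ≤ mev (f i) x <;> by_cases h2 : b i = true <;> simp [h1, h2] at hi ⊢
  · exact mul_nonneg hr'.le h1
  · exact mul_nonpos_of_nonneg_of_nonpos hr'.le (not_le.1 h1).le

theorem smoothInd_eq_one {κ ι : Type} [Fintype κ] [Fintype ι] {r : ℝ} (hr : 0 < r)
    (f : κ → Finset ι → ℝ) (x : ι → ℝ) (h : ∀ i, r < |mev (f i) x|) :
    smoothInd r f (pattern f x) x = 1 := by
  refine Finset.prod_eq_one fun i _ => Real.smoothTransition.one_of_one_le ?_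
  have hi := h i
  rw [mev_signScale]
  unfold pattern
  have e : r⁻¹ * |mev (f i) x| = (if (if 0 ≤ mev (f i) x then true else false) = true
      then r⁻¹ else -r⁻¹) * mev (f i) x := by
    split_ifs with h1 h2 h2
    · rw [abs_of_nonneg h1]
    · simp at h2
    · simp at h2
    · rw [abs_of_neg (not_le.1 h1)]; ring
  rw [← e, inv_mul_eq_div, le_div_iff₀ hr, one_mul]
  exact hi.le

theorem continuous_smoothInd {κ ι : Type} [Fintype κ] [Fintype ι] (r : ℝ)
    (f : κ → Finset ι → ℝ) (b : κ → Bool) : Continuous (smoothInd r f b) :=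
  continuous_finsetProd _ fun _ _ =>
    Real.smoothTransition.continuous.comp (isPoly_mev _).continuous

theorem integrable_smoothInd {κ ι : Type} [Fintype κ] [Fintype ι] (r : ℝ)
    (f : κ → Finset ι → ℝ) (b : κ → Bool) (μ : Measure (ι → ℝ)) [IsProbabilityMeasure μ] :
    Integrable (smoothInd r f b) μ := by
  refine Integrable.of_bound (continuous_smoothInd r f b).aestronglyMeasurable 1
    (Filter.Eventually.of_forall fun x => ?_)
  rw [Real.norm_eq_abs, abs_of_nonneg (smoothInd_nonneg r f b x)]
  exact smoothInd_le_one r f b x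

theorem sum_integral_smoothInd_le {κ ι : Type} [Fintype κ] [Fintype ι] {r : ℝ} (hr : 0 < r)
    (f : κ → Finset ι → ℝ) (g : (κ → Bool) → Bool) (μ : Measure (ι → ℝ))
    [IsProbabilityMeasure μ] :
    ∑ b with g b = true, ∫ x, smoothInd r f b x ∂μ ≤ μ.real {x | g (pattern f x) = true} := by
  have hm := measurableSet_pattern f g
  rw [← integral_indicator_one hm, ← integral_finsetSum _ fun b _ => integrable_smoothInd r f b μ]
  refine integral_mono (integrable_finsetSum _ fun b _ => integrable_smoothInd r f b μ)
    ((integrable_const 1).indicator hm) fun x => ?_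
  by_cases hx : g (pattern f x) = true
  · rw [Set.indicator_of_mem (by exact hx), Finset.sum_eq_single (pattern f x)
      (fun b _ hb => smoothInd_eq_zero hr f b x hb) (fun h => by simp [hx] at h)]
    exact smoothInd_le_one _ _ _ _
  · rw [Set.indicator_of_notMem (by exact hx)]
    refine (Finset.sum_eq_zero fun b hb => smoothInd_eq_zero hr f b x ?_).le
    rintro rfl
    exact hx (Finset.mem_filter.1 hb).2

theorem le_sum_integral_smoothInd {κ ι : Type} [Fintype κ] [Fintype ι] {r : ℝ} (hr : 0 < r)
    (f : κ → Finset ι → ℝ) (g : (κ → Bool) → Bool) (μ : Measure (ι → ℝ))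
    [IsProbabilityMeasure μ] :
    μ.real {x | g (pattern f x) = true} ≤ ∑ b with g b = true, ∫ x, smoothInd r f b x ∂μ
      + ∑ i, μ.real {x | |mev (f i) x| ≤ r} := by
  have hm := measurableSet_pattern f g
  have hs : ∀ i, MeasurableSet {x | |mev (f i) x| ≤ r} := fun i =>
    (isClosed_le (isPoly_mev (f i)).continuous.abs continuous_const).measurableSet
  have i1 : Integrable (fun x => ∑ b with g b = true, smoothInd r f b x) μ :=
    integrable_finsetSum _ fun b _ => integrable_smoothInd r f b μ
  have i2 : ∀ i, Integrable (Set.indicator {x | |mev (f i) x| ≤ r} (1 : (ι → ℝ) → ℝ)) μ :=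
    fun i => (integrable_const 1).indicator (hs i)
  simp_rw [← fun i => integral_indicator_one (μ := μ) (hs i)]
  rw [← integral_indicator_one hm, ← integral_finsetSum _ fun b _ => integrable_smoothInd r f b μ,
    ← integral_finsetSum _ fun i _ => i2 i, ← integral_add i1 (integrable_finsetSum _ fun i _ => i2 i)]
  refine integral_mono ((integrable_const 1).indicator hm)
    (i1.add (integrable_finsetSum _ fun i _ => i2 i)) fun x => ?_
  have h0 : 0 ≤ ∑ b with g b = true, smoothInd r f b x :=
    Finset.sum_nonneg fun b _ => smoothInd_nonneg r f b x
  have h1 : ∀ i, 0 ≤ Set.indicator {x | |mev (f i) x| ≤ r} (1 : (ι → ℝ) → ℝ) x := fun i =>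
    Set.indicator_nonneg (fun _ _ => zero_le_one) x
  change _ ≤ ∑ b with g b = true, smoothInd r f b x
    + ∑ i, Set.indicator {x | |mev (f i) x| ≤ r} (1 : (ι → ℝ) → ℝ) x
  by_cases hx : g (pattern f x) = true
  · rw [Set.indicator_of_mem (by exact hx)]
    by_cases hall : ∀ i, r < |mev (f i) x|
    · have h2 := Finset.single_le_sum (f := fun b => smoothInd r f b x)
        (s := Finset.univ.filter fun b => g b = true) (fun b _ => smoothInd_nonneg r f b x)
        (Finset.mem_filter.2 ⟨Finset.mem_univ _, hx⟩)
      simp only [smoothInd_eq_one hr f x hall] at h2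
      exact h2.trans (le_add_of_nonneg_right (Finset.sum_nonneg fun i _ => h1 i))
    · push Not at hall
      obtain ⟨i, hi⟩ := hall
      have h2 := Finset.single_le_sum (fun i _ => h1 i) (Finset.mem_univ i)
      rw [Set.indicator_of_mem (by exact hi)] at h2
      exact h2.trans (le_add_of_nonneg_left h0)
  · rw [Set.indicator_of_notMem (by exact hx)]
    exact add_nonneg h0 (Finset.sum_nonneg fun i _ => h1 i)

theorem gam_real_small_le {ι : Type} [Fintype ι] {d : ℕ} {f : Finset ι → ℝ}
    (hf : ∀ S, d < S.card → f S = 0) (hf1 : 1 ≤ ∑ S, f S ^ 2) {ε r : ℝ} (hε : 0 < ε)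
    (hε1 : ε ≤ 1) (hr : r ^ 2 ≤ ε ^ (3 * d) / 4) :
    (gam ι).real {x | |mev f x| ≤ r} ≤ 20736 * (d + 1) ^ 3 * ε := by
  have h := gam_small_ball d Unit (fun _ => f) (fun _ => hf) 1 ε one_pos hε hε1 (by simpa using hf1)
  refine ENNReal.toReal_le_of_le_ofReal (by positivity) ((measure_mono fun x hx => ?_).trans h)
  have hx' : |mev f x| ≤ r := hx
  have h2 := pow_le_pow_left₀ (abs_nonneg _) hx' 2
  rw [sq_abs] at h2
  simpa using h2.trans hr

/-- One-sided comparison of pattern probabilities for normalised families. -/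
theorem gam_pattern_le {κ ι : Type} [Fintype κ] [Fintype ι] {K : ℝ} (hK : 1 ≤ K)
    (hφ : ∀ j ≤ 4, ∀ x, |iteratedDeriv j Real.smoothTransition x| ≤ K ^ j) {d : ℕ}
    {f : κ → Finset ι → ℝ} (hf : ∀ i S, d < S.card → f i S = 0)
    (hf1 : ∀ i, 1 ≤ ∑ S, f i S ^ 2) {ε r θ : ℝ} (hε : 0 < ε) (hε1 : ε ≤ 1) (hr0 : 0 < r)
    (hr : r ^ 2 ≤ ε ^ (3 * d) / 4)
    (hθ : ∀ i, ∑ l, (∑ S, mder l (f i) S ^ 2) ^ 2 ≤ θ) (g : (κ → Bool) → Bool) :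
    (gam ι).real {x | g (pattern f x) = true}
      ≤ (Measure.pi fun _ : ι => rad).real {x | g (pattern f x) = true}
        + (2 ^ Fintype.card κ * (K ^ 4 * Fintype.card κ ^ 4 / 4 * 9 ^ d * ((r ^ 4)⁻¹ * θ))
        + Fintype.card κ * (20736 * (d + 1) ^ 3 * ε)) := by
  have h1 := le_sum_integral_smoothInd hr0 f g (gam ι)
  have h2 := sum_integral_smoothInd_le hr0 f g (Measure.pi fun _ : ι => rad)
  have h3 : ∑ i, (gam ι).real {x | |mev (f i) x| ≤ r}
      ≤ Fintype.card κ * (20736 * (d + 1) ^ 3 * ε) := by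
    refine (Finset.sum_le_sum fun i _ => gam_real_small_le (hf i) (hf1 i) hε hε1 hr).trans ?_
    simp
  set E := K ^ 4 * Fintype.card κ ^ 4 / 4 * 9 ^ d * ((r ^ 4)⁻¹ * θ) with hE
  have h4 : ∀ b, ∫ x, smoothInd r f b x ∂(gam ι)
      ≤ ∫ x, smoothInd r f b x ∂(Measure.pi fun _ : ι => rad) + E := by
    intro b
    have h5 := abs_integral_rad_sub_gam_le hK hφ d (signScale b r f) fun i S hS => by
      simp [signScale, hf i S hS]
    have h6 : ∑ l, ∑ i, (∑ S, mder l (signScale b r f i) S ^ 2) ^ 2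
        ≤ Fintype.card κ * ((r ^ 4)⁻¹ * θ) := by
      rw [Finset.sum_comm]
      simp_rw [mder_signScale_sq, ← Finset.mul_sum, mul_pow]
      refine (Finset.sum_le_sum (g := fun _ => (r ^ 4)⁻¹ * θ) fun i _ => ?_).trans (by simp)
      rw [← Finset.mul_sum, inv_pow, ← pow_mul]
      exact mul_le_mul_of_nonneg_left (hθ i) (by positivity)
    have h7 := (le_abs_self _).trans h5
    have h8 : K ^ 4 * Fintype.card κ ^ 3 / 4 * 9 ^ d
        * ∑ l, ∑ i, (∑ S, mder l (signScale b r f i) S ^ 2) ^ 2 ≤ E := by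
      refine (mul_le_mul_of_nonneg_left h6 (by positivity)).trans (le_of_eq ?_)
      rw [hE]; ring
    change ∫ x, ∏ i, Real.smoothTransition (mev (signScale b r f i) x) ∂(gam ι)
      ≤ ∫ x, ∏ i, Real.smoothTransition (mev (signScale b r f i) x)
        ∂(Measure.pi fun _ : ι => rad) + E
    linarith
  have hE0 : Nonempty κ → 0 ≤ E := fun ⟨i⟩ => by
    have : 0 ≤ θ := (Finset.sum_nonneg fun l _ => sq_nonneg _).trans (hθ i)
    positivity
  have hE0' : 0 ≤ E := by
    rcases isEmpty_or_nonempty κ with h | h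
    · simp [hE]
    · exact hE0 h
  have h9 : ∑ b with g b = true, ∫ x, smoothInd r f b x ∂(gam ι)
      ≤ ∑ b with g b = true, ∫ x, smoothInd r f b x ∂(Measure.pi fun _ : ι => rad)
        + 2 ^ Fintype.card κ * E := by
    refine (Finset.sum_le_sum fun b _ => h4 b).trans ?_
    rw [Finset.sum_add_distrib]
    gcongr
    rw [Finset.sum_const, nsmul_eq_mul]
    gcongr
    have := Finset.card_filter_le (Finset.univ : Finset (κ → Bool)) fun b => g b = true
    rw [Finset.card_univ, Fintype.card_fun, Fintype.card_bool] at this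
    exact_mod_cast this
  linarith

theorem abs_rad_sub_gam_pattern_le {κ ι : Type} [Fintype κ] [Fintype ι] {K : ℝ} (hK : 1 ≤ K)
    (hφ : ∀ j ≤ 4, ∀ x, |iteratedDeriv j Real.smoothTransition x| ≤ K ^ j) {d : ℕ}
    {f : κ → Finset ι → ℝ} (hf : ∀ i S, d < S.card → f i S = 0)
    (hf1 : ∀ i, 1 ≤ ∑ S, f i S ^ 2) {ε r θ : ℝ} (hε : 0 < ε) (hε1 : ε ≤ 1) (hr0 : 0 < r)
    (hr : r ^ 2 ≤ ε ^ (3 * d) / 4)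
    (hθ : ∀ i, ∑ l, (∑ S, mder l (f i) S ^ 2) ^ 2 ≤ θ) (g : (κ → Bool) → Bool) :
    |(Measure.pi fun _ : ι => rad).real {x | g (pattern f x) = true}
        - (gam ι).real {x | g (pattern f x) = true}|
      ≤ 2 ^ Fintype.card κ * (K ^ 4 * Fintype.card κ ^ 4 / 4 * 9 ^ d * ((r ^ 4)⁻¹ * θ))
        + Fintype.card κ * (20736 * (d + 1) ^ 3 * ε) := by
  have h1 := gam_pattern_le hK hφ hf hf1 hε hε1 hr0 hr hθ g
  have h2 := gam_pattern_le hK hφ hf hf1 hε hε1 hr0 hr hθ fun b => !g b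
  have e : {x | (!g (pattern f x)) = true} = {x | g (pattern f x) = true}ᶜ := by
    ext x; simp
  rw [e, probReal_compl_eq_one_sub (measurableSet_pattern f g),
    probReal_compl_eq_one_sub (measurableSet_pattern f g)] at h2
  rw [abs_le]
  constructor <;> linarith

theorem pattern_congr {κ ι : Type} [Fintype ι] {f f' : κ → Finset ι → ℝ}
    (h : ∀ i x, 0 ≤ mev (f' i) x ↔ 0 ≤ mev (f i) x) (x : ι → ℝ) :
    pattern f' x = pattern f x := by
  funext i
  unfold pattern
  simp only [h i x]

theorem coeff_eq_zero_of_bvar_eq_zero {n : ℕ} {f : Finset (Fin n) → ℝ} (h : bvar f = 0) :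
    ∀ S, S ≠ ∅ → f S = 0 := by
  intro S hS
  unfold bvar at h
  rw [Finset.sum_eq_zero_iff_of_nonneg (fun T _ => by split_ifs <;> positivity)] at h
  have := h S (Finset.mem_univ S)
  rw [if_pos hS] at this
  exact pow_eq_zero_iff (two_ne_zero) |>.1 this

theorem bvar_nonneg {n : ℕ} (f : Finset (Fin n) → ℝ) : 0 ≤ bvar f :=
  Finset.sum_nonneg fun S _ => by split_ifs <;> positivity

theorem sq_le_binf {n : ℕ} (f : Finset (Fin n) → ℝ) {l : Fin n} {S : Finset (Fin n)}
    (h : l ∈ S) : f S ^ 2 ≤ binf f l := by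
  have := Finset.single_le_sum (f := fun S : Finset (Fin n) => if l ∈ S then f S ^ 2 else 0)
    (fun T _ => by split_ifs <;> positivity) (Finset.mem_univ S)
  rw [if_pos h] at this
  exact this

/-- A regular polynomial can be normalized to have unit variance (or to be `±1` if it is constant)
without changing its sign. -/
theorem exists_normalized {n d : ℕ} {τ : ℝ} (hτ : 0 ≤ τ) {f : Finset (Fin n) → ℝ}
    (hf : degLE f d) (hreg : ∀ l, binf f l ≤ τ * bvar f) :
    ∃ f' : Finset (Fin n) → ℝ, (∀ S, d < S.card → f' S = 0) ∧
      (∀ x, 0 ≤ mev f' x ↔ 0 ≤ mev f x) ∧ 1 ≤ ∑ S, f' S ^ 2 ∧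
      ∑ l, (∑ S, mder l f' S ^ 2) ^ 2 ≤ τ * d := by
  rcases (bvar_nonneg f).eq_or_lt with h0 | h0
  · have hc := coeff_eq_zero_of_bvar_eq_zero h0.symm
    have hs : ∃ s : ℝ, s ^ 2 = 1 ∧ (0 ≤ s ↔ 0 ≤ f ∅) := by
      by_cases h : 0 ≤ f ∅
      · exact ⟨1, by norm_num, by simp [h]⟩
      · exact ⟨-1, by norm_num, by simp only [h, iff_false]; norm_num⟩
    obtain ⟨s, hs1, hs2⟩ := hs
    have hc' : ∀ S : Finset (Fin n), S ≠ ∅ → (if S = ∅ then s else 0) = 0 :=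
      fun S hS => if_neg hS
    refine ⟨fun S => if S = ∅ then s else 0, fun S hS => ?_, fun x => ?_, ?_, ?_⟩
    · exact if_neg fun h => by simp [h] at hS
    · rw [mev_eq_const _ hc', mev_eq_const _ hc, if_pos rfl, hs2]
    · refine le_of_eq ?_
      rw [Finset.sum_eq_single ∅ (fun S _ hS => by simp [hS]) (by simp)]
      simp [hs1]
    · have : ∀ l : Fin n, ∑ S, mder l (fun S : Finset (Fin n) => if S = ∅ then s else 0) S ^ 2
          = 0 := fun l => by
        rw [sum_mder_sq]
        refine Finset.sum_eq_zero fun S _ => ?_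
        split_ifs with h1 h2
        · simp [h2] at h1
        · norm_num
        · rfl
      simp only [this]
      refine le_trans (le_of_eq ?_) (mul_nonneg hτ d.cast_nonneg)
      simp
  · set a := (Real.sqrt (bvar f))⁻¹ with ha
    have ha0 : 0 < a := inv_pos.2 (Real.sqrt_pos.2 h0)
    have ha2 : a ^ 2 = (bvar f)⁻¹ := by rw [ha, inv_pow, Real.sq_sqrt h0.le]
    have hinf : ∀ l, ∑ S, mder l (fun S => a * f S) S ^ 2 = a ^ 2 * binf f l := fun l => by
      rw [sum_mder_sq, binf, Finset.mul_sum]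
      refine Finset.sum_congr rfl fun S _ => ?_
      split_ifs <;> ring
    have hvar : a ^ 2 * bvar f = 1 := by rw [ha2, inv_mul_cancel₀ h0.ne']
    refine ⟨fun S => a * f S, fun S hS => by simp [hf S hS], fun x => ?_, ?_, ?_⟩
    · have : mev (fun S => a * f S) x = a * mev f x := by
        unfold mev
        rw [Finset.mul_sum]
        exact Finset.sum_congr rfl fun S _ => mul_assoc _ _ _
      rw [this, mul_nonneg_iff_of_pos_left ha0]
    · rw [← hvar, bvar, Finset.mul_sum]
      refine Finset.sum_le_sum fun S _ => ?_
      split_ifs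
      · rw [mul_pow]
      · rw [mul_zero]; exact sq_nonneg _
    · have h1 : ∀ l, ∑ S, mder l (fun S => a * f S) S ^ 2 ≤ τ := fun l => by
        rw [hinf]
        calc a ^ 2 * binf f l ≤ a ^ 2 * (τ * bvar f) := by gcongr; exact hreg l
          _ = τ * (a ^ 2 * bvar f) := by ring
          _ = τ := by rw [hvar, mul_one]
      have h2 : ∑ l, ∑ S, mder l (fun S => a * f S) S ^ 2 ≤ d := by
        rw [sum_sum_mder_sq]
        calc ∑ S, (S.card : ℝ) * (a * f S) ^ 2
            ≤ ∑ S, d * (a ^ 2 * if S ≠ ∅ then f S ^ 2 else 0) := by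
              refine Finset.sum_le_sum fun S _ => ?_
              by_cases hS : S = ∅
              · simp [hS]
              · rw [if_pos hS, ← mul_pow]
                rcases le_or_gt S.card d with h | h
                · gcongr
                · simp [hf S h]
          _ = d * (a ^ 2 * bvar f) := by rw [bvar, Finset.mul_sum, Finset.mul_sum]
          _ = d := by rw [hvar, mul_one]
      calc ∑ l, (∑ S, mder l (fun S => a * f S) S ^ 2) ^ 2
          ≤ ∑ l, τ * ∑ S, mder l (fun S => a * f S) S ^ 2 := by
            refine Finset.sum_le_sum fun l _ => ?_
            rw [pow_two]
            exact mul_le_mul_of_nonneg_right (h1 l) (Finset.sum_nonneg fun S _ => sq_nonneg _)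
        _ = τ * ∑ l, ∑ S, mder l (fun S => a * f S) S ^ 2 := by rw [Finset.mul_sum]
        _ ≤ τ * d := by gcongr

theorem natCast_le_two_pow (m : ℕ) : (m : ℝ) ≤ 2 ^ m := by
  exact_mod_cast (Nat.lt_two_pow_self (n := m)).le

theorem invariance_bound {n k d : ℕ} {K τ : ℝ} (hK : 1 ≤ K)
    (hφ : ∀ j ≤ 4, ∀ x, |iteratedDeriv j Real.smoothTransition x| ≤ K ^ j) (hd : 0 < d)
    (hτ0 : 0 < τ) (hτ1 : τ ≤ 1) {f : Fin k → Finset (Fin n) → ℝ} (hf : ∀ i, degLE (f i) d)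
    (hreg : ∀ i l, binf (f i) l ≤ τ * bvar (f i)) (g : (Fin k → Bool) → Bool) :
    |(Measure.pi fun _ : Fin n => rad).real {x | g (pattern f x) = true}
        - (gam (Fin n)).real {x | g (pattern f x) = true}|
      ≤ (4 * K ^ 4 + 20736) * 32 ^ k * 32 ^ d * τ ^ (1 / (8 * (d : ℝ))) := by
  choose f' h1 h2 h3 h4 using fun i => exists_normalized hτ0.le (hf i) (hreg i)
  have hp : ∀ x, pattern f' x = pattern f x := pattern_congr h2
  have hd' : (1 : ℝ) ≤ d := by exact_mod_cast hd
  set ε := τ ^ (1 / (8 * (d : ℝ))) with hε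
  have hε0 : 0 < ε := Real.rpow_pos_of_pos hτ0 _
  have hε1 : ε ≤ 1 := Real.rpow_le_one hτ0.le hτ1 (by positivity)
  have hε3 : ε ^ (3 * d) = τ ^ (3 / 8 : ℝ) := by
    rw [hε, ← Real.rpow_natCast, ← Real.rpow_mul hτ0.le]
    congr 1
    push_cast
    field_simp
  set r := τ ^ (3 / 16 : ℝ) / 2 with hr
  have hr0 : 0 < r := by have := Real.rpow_pos_of_pos hτ0 (3 / 16 : ℝ); positivity
  have hr2 : r ^ 2 = τ ^ (3 / 8 : ℝ) / 4 := by
    rw [hr, div_pow, ← Real.rpow_natCast, ← Real.rpow_mul hτ0.le]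
    norm_num
  have hr4 : (r ^ 4)⁻¹ * (τ * d) = 16 * d * τ ^ (1 / 4 : ℝ) := by
    have e : r ^ 4 = τ ^ (3 / 4 : ℝ) / 16 := by
      rw [hr, div_pow, ← Real.rpow_natCast, ← Real.rpow_mul hτ0.le]
      norm_num
    have e2 : τ = τ ^ (3 / 4 : ℝ) * τ ^ (1 / 4 : ℝ) := by
      rw [← Real.rpow_add hτ0]; norm_num
    have h0 := Real.rpow_pos_of_pos hτ0 (3 / 4 : ℝ)
    rw [e, inv_div, div_mul_eq_mul_div, div_eq_iff h0.ne']
    linear_combination 16 * d * e2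
  have hτε : τ ^ (1 / 4 : ℝ) ≤ ε := by
    refine Real.rpow_le_rpow_of_exponent_ge hτ0 hτ1 ?_
    rw [div_le_div_iff₀ (by positivity) (by norm_num)]
    linarith
  have := abs_rad_sub_gam_pattern_le hK hφ h1 h3 hε0 hε1 hr0 (by rw [hr2, hε3])
    (fun i => by convert h4 i) g
  simp only [hp, Fintype.card_fin, hr4] at this
  refine this.trans ?_
  have hk4 : (k : ℝ) ^ 4 ≤ 16 ^ k := by
    calc (k : ℝ) ^ 4 ≤ (2 ^ k) ^ 4 := by gcongr; exact natCast_le_two_pow k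
      _ = 16 ^ k := by rw [← pow_mul, mul_comm, pow_mul]; norm_num
  have hk : (k : ℝ) ≤ 32 ^ k :=
    (natCast_le_two_pow k).trans (by gcongr; norm_num)
  have hdd : (d : ℝ) ≤ 2 ^ d := natCast_le_two_pow d
  have hd3 : ((d : ℝ) + 1) ^ 3 ≤ 32 ^ d := by
    have : (d : ℝ) + 1 ≤ 2 ^ d := by exact_mod_cast Nat.lt_two_pow_self (n := d)
    calc ((d : ℝ) + 1) ^ 3 ≤ (2 ^ d) ^ 3 := by gcongr
      _ = 8 ^ d := by rw [← pow_mul, mul_comm, pow_mul]; norm_num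
      _ ≤ 32 ^ d := by gcongr; norm_num
  have e1 : (2 : ℝ) ^ k * (K ^ 4 * k ^ 4 / 4 * 9 ^ d * (16 * d * τ ^ (1 / 4 : ℝ)))
      ≤ 4 * K ^ 4 * 32 ^ k * 32 ^ d * ε := by
    calc (2 : ℝ) ^ k * (K ^ 4 * k ^ 4 / 4 * 9 ^ d * (16 * d * τ ^ (1 / 4 : ℝ)))
        ≤ 2 ^ k * (K ^ 4 * 16 ^ k / 4 * 9 ^ d * (16 * 2 ^ d * ε)) := by gcongr
      _ = 4 * K ^ 4 * (2 * 16) ^ k * (9 * 2) ^ d * ε := by rw [mul_pow, mul_pow]; ring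
      _ ≤ 4 * K ^ 4 * 32 ^ k * 32 ^ d * ε := by gcongr <;> norm_num
  have e2 : (k : ℝ) * (20736 * (d + 1) ^ 3 * ε) ≤ 20736 * 32 ^ k * 32 ^ d * ε := by
    calc (k : ℝ) * (20736 * (d + 1) ^ 3 * ε) ≤ 32 ^ k * (20736 * 32 ^ d * ε) := by gcongr
      _ = 20736 * 32 ^ k * 32 ^ d * ε := by ring
  linarith

theorem abs_measureReal_sub_le_one {α : Type} [MeasurableSpace α] (μ ν : Measure α)
    [IsProbabilityMeasure μ] [IsProbabilityMeasure ν] (s : Set α) :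
    |μ.real s - ν.real s| ≤ 1 := by
  have h1 : μ.real s ≤ 1 := measureReal_le_one
  have h2 : ν.real s ≤ 1 := measureReal_le_one
  have h3 : 0 ≤ μ.real s := measureReal_nonneg
  have h4 : 0 ≤ ν.real s := measureReal_nonneg
  rw [abs_le]
  constructor <;> linarith

theorem abs_measureReal_sub_eq_zero_of_const {α : Type} [MeasurableSpace α] (μ ν : Measure α)
    [IsProbabilityMeasure μ] [IsProbabilityMeasure ν] (P : Prop) :
    |μ.real {_x : α | P} - ν.real {_x : α | P}| = 0 := by
  by_cases h : P <;> simp [h]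

/-- If the regularity parameter is not positive, all polynomials are constant. -/
theorem coeff_eq_zero_of_nonpos {n : ℕ} {τ : ℝ} (hτ : τ ≤ 0) {f : Finset (Fin n) → ℝ}
    (hreg : ∀ l, binf f l ≤ τ * bvar f) : ∀ S, S ≠ ∅ → f S = 0 := by
  intro S hS
  obtain ⟨l, hl⟩ := Finset.nonempty_iff_ne_empty.2 hS
  have h1 := sq_le_binf f hl
  have h2 := hreg l
  have h3 : τ * bvar f ≤ 0 := mul_nonpos_of_nonpos_of_nonneg hτ (bvar_nonneg f)
  exact pow_eq_zero_iff two_ne_zero |>.1 (le_antisymm (by linarith) (sq_nonneg _))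

theorem rpow_one_div_eight_mul_nonneg (τ : ℝ) {d : ℕ} (hd : 0 < d) :
    0 ≤ τ ^ (1 / (8 * (d : ℝ))) := by
  rcases le_or_gt 0 τ with h | h
  · exact Real.rpow_nonneg h _
  · rw [Real.rpow_def_of_neg h]
    refine mul_nonneg (Real.exp_pos _).le (Real.cos_nonneg_of_mem_Icc ⟨?_, ?_⟩)
    · have : 0 ≤ 1 / (8 * (d : ℝ)) * Real.pi := by positivity
      linarith [Real.pi_pos]
    · have hd' : (1 : ℝ) ≤ d := by exact_mod_cast hd
      have : 1 / (8 * (d : ℝ)) ≤ 1 / 2 := by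
        rw [div_le_div_iff₀ (by positivity) (by norm_num)]
        linarith
      nlinarith [Real.pi_pos]

end Multilin

/-- multidimensional invariance principle for juntas of regular low-degree
PTFs.  Here `g : {-1,1}^k → {-1,1}` is encoded as `g : (Fin k → Bool) → Bool`, with
`true ↔ 1`, and `sign(p_i(x)) = 1 ↔ 0 ≤ p_i(x)`. -/
theorem stmt_10 :
    ∃ c : ℝ, 0 < c ∧
      ∀ (n k d : ℕ) (τ : ℝ) (f : Fin k → Finset (Fin n) → ℝ),
        (∀ i, degLE (f i) d) →
        (∀ (i : Fin k) (l : Fin n), binf (f i) l ≤ τ * bvar (f i)) →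
        ∀ g : (Fin k → Bool) → Bool,
          |bprob n (fun x =>
              g (fun i => if 0 ≤ peval (f i) x then true else false) = true) -
            ((stdGaussian n) {x |
              g (fun i => if 0 ≤ peval (f i) x then true else false) = true}).toReal|
            ≤ (2 : ℝ) ^ (c * k) * (2 : ℝ) ^ (c * d) * τ ^ (1 / (8 * (d : ℝ))) := by
  obtain ⟨K, hK, hφ⟩ := Multilin.exists_bound_smoothTransition
  set C : ℝ := 4 * K ^ 4 + 20736 with hC
  have hC1 : 1 ≤ C := by
    have : 0 ≤ 4 * K ^ 4 := by positivity
    linarith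
  have hc0 : 0 < Real.logb 2 (32 * C) := Real.logb_pos (by norm_num) (by linarith)
  refine ⟨Real.logb 2 (32 * C), hc0, fun n k d τ f hf hreg g => ?_⟩
  have hpow : ∀ m : ℕ, (2 : ℝ) ^ (Real.logb 2 (32 * C) * m) = (32 * C) ^ m := fun m => by
    rw [Real.rpow_mul (by norm_num), Real.rpow_logb (by norm_num) (by norm_num) (by linarith),
      Real.rpow_natCast]
  have hone : ∀ m : ℕ, 1 ≤ (32 * C) ^ m := fun m => one_le_pow₀ (by linarith)
  rw [hpow, hpow]
  change |bprob n (fun x => g (Multilin.pattern f x) = true)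
    - (Multilin.gam (Fin n)).real {x | g (Multilin.pattern f x) = true}| ≤ _
  rw [Multilin.bprob_eq n _ (Multilin.measurableSet_pattern f g)]
  change |(Measure.pi fun _ : Fin n => Multilin.rad).real
      {x | g (Multilin.pattern f x) = true}
    - (Multilin.gam (Fin n)).real {x | g (Multilin.pattern f x) = true}| ≤ _
  have htriv := Multilin.abs_measureReal_sub_le_one (Measure.pi fun _ : Fin n => Multilin.rad)
    (Multilin.gam (Fin n)) {x | g (Multilin.pattern f x) = true}
  have hkd : 1 ≤ (32 * C) ^ k * (32 * C) ^ d := one_le_mul_of_one_le_of_one_le (hone k) (hone d)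
  rcases Nat.eq_zero_or_pos d with rfl | hd
  · refine htriv.trans ?_
    simpa using hone k
  rcases le_or_gt τ 0 with hτ | hτ
  · have hconst : ∀ x, Multilin.pattern f x = Multilin.pattern f 0 := fun x => by
      funext i
      unfold Multilin.pattern
      rw [Multilin.mev_eq_const _ (Multilin.coeff_eq_zero_of_nonpos hτ (hreg i)),
        Multilin.mev_eq_const _ (Multilin.coeff_eq_zero_of_nonpos hτ (hreg i))]
    simp only [hconst]
    rw [Multilin.abs_measureReal_sub_eq_zero_of_const]
    exact mul_nonneg (by linarith) (Multilin.rpow_one_div_eight_mul_nonneg τ hd)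
  rcases le_or_gt τ 1 with hτ1 | hτ1
  · refine (Multilin.invariance_bound hK hφ hd hτ hτ1 hf hreg g).trans ?_
    refine mul_le_mul_of_nonneg_right ?_ (Multilin.rpow_one_div_eight_mul_nonneg τ hd)
    have h1 : (32 : ℝ) ^ k ≤ (32 * C) ^ k := by gcongr; linarith
    have h2 : C * 32 ^ d ≤ (32 * C) ^ d := by
      rw [mul_pow, mul_comm]
      gcongr
      exact le_self_pow₀ hC1 hd.ne'
    calc C * 32 ^ k * 32 ^ d = 32 ^ k * (C * 32 ^ d) := by ring
      _ ≤ _ := by gcongr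
  · exact htriv.trans (one_le_mul_of_one_le_of_one_le hkd
      (Real.one_le_rpow hτ1.le (by positivity)))
end
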